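/- arXiv:2305.11677 — 2 statements merged into one kernel-verified Lean document; each statement's English description precedes it below -/
import Mathlib

section
/- Let q be an odd prime power, let m ≡ 2 (mod 4) with m ≥ 6, and let n = q^m + 1. Set δ_3 = (q-1)^2 (q^m - 2q^{m-4} - 1)/(2(q^2+1)), and set δ_4 = δ_3 - q(q-1)^2 if m = 6 and δ_4 = δ_3 - (q-1)^2(q^2-1) if m > 6. Then δ_3 and δ_4 are, respectively, the third and fourth largest coset leaders modulo n, i.e. δ_{3,n} = δ_3 and δ_{4,n} = δ_4. Moreover, the q-cyclotomic cosets of δ_3 and of δ_4 modulo n each have exactly 2m elements. -/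
/-- The `q`-cyclotomic coset of `s` modulo `n`:
`C_s = { s·q^j mod n : 0 ≤ j ≤ ord_n(q) - 1 }`. -/
noncomputable def cycCoset (q n s : ℕ) : Finset ℕ :=
  (Finset.range (orderOf (q : ZMod n))).image fun j => s * q ^ j % n

/-- `s` is a coset leader modulo `n` iff `s = min C_s`. -/
def IsCosetLeader (q n s : ℕ) : Prop :=
  s ∈ cycCoset q n s ∧ ∀ x ∈ cycCoset q n s, s ≤ x

/-- The set of coset leaders modulo `n` (as a finset of `{0, …, n-1}`). -/
noncomputable def cosetLeaders (q n : ℕ) : Finset ℕ :=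
  (Finset.range n).filter fun s => s ∈ cycCoset q n s ∧ ∀ x ∈ cycCoset q n s, s ≤ x

/-- The `i`-th largest coset leader modulo `n` (for `i ≥ 1`), i.e. `δ_{i,n}`. -/
noncomputable def nthLargestCosetLeader (q n i : ℕ) : ℕ :=
  (((cosetLeaders q n).sort (· ≤ ·)).reverse).getD (i - 1) 0



/-- Combinatorial core: the renormalised dynamics `E ↦ -Q E` or `E ↦ N + Q E`. -/
lemma dyn_core (l : ℕ) (hl : 2 ≤ l) (Q K N : ℤ) (hQ : 9 ≤ Q) (hK : 1 ≤ K)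
    (hN : N = K * (Q ^ (2 * l + 1) + 1)) (σ E : ℕ → ℤ) (hσ0 : σ 0 = 1)
    (hσM : σ (2 * l + 1) = -1) (hEM : E (2 * l + 1) = E 0)
    (hs : ∀ i, (σ (i+1) = -σ i ∧ E (i+1) = -Q * E i) ∨ (σ (i+1) = σ i ∧ E (i+1) = N + Q * E i))
    (hub : ∀ i, E i ≤ E 0) (hlb : ∀ i, -Q * E 0 ≤ E i)
    (h0 : 0 < E 0) (hE0 : E 0 ≤ K * (Q ^ (2 * l - 1) + Q ^ 2)) :
    E 0 = K * (Q ^ (2 * l - 1) + 1) ∨ E 0 = K * (Q ^ (2 * l - 1) + Q ^ 2) := by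
  obtain ⟨k, rfl⟩ : ∃ k, l = k + 2 := ⟨l - 2, by omega⟩
  have e1 : 2 * (k + 2) - 1 = 2 * k + 3 := by omega
  have e2 : 2 * (k + 2) + 1 = 2 * k + 5 := by omega
  rw [e1] at hE0 ⊢
  rw [e2] at hN hσM hEM
  clear e1 e2 hl
  set X : ℤ := Q ^ (2 * k) with hX
  have hX1 : 1 ≤ X := one_le_pow₀ (by linarith)
  have p3 : Q ^ (2 * k + 3) = X * Q ^ 3 := by rw [pow_add]
  have p5 : Q ^ (2 * k + 5) = X * Q ^ 5 := by rw [pow_add]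
  rw [p3] at hE0 ⊢
  rw [p5] at hN
  -- E 0 < N
  have hEN : E 0 < N := by
    have : (0:ℤ) < (X * Q ^ 5 + 1) - (X * Q ^ 3 + Q ^ 2) := by
      obtain ⟨a, rfl⟩ : ∃ a, Q = a + 9 := ⟨Q - 9, by ring⟩
      obtain ⟨b, hb⟩ : ∃ b, X = b + 1 := ⟨X - 1, by ring⟩
      rw [hb]
      have ha : 0 ≤ a := by linarith
      have hb' : 0 ≤ b := by linarith
      ring_nf
      positivity
    rw [hN]
    nlinarith
  -- a `BB` step needs a negative state
  have hneg : ∀ i, E (i+1) = N + Q * E i → E i < 0 := by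
    intro i hi
    have := hub (i+1)
    by_contra hc
    push Not at hc
    nlinarith
  -- Step 1
  have hG : 0 < Q ^ 2 * E 0 - N := by
    by_contra hc
    have key : ∀ i, 0 ≤ (-1) ^ i * E i := by
      intro i
      induction i with
      | zero => simpa using h0.le
      | succ i ih =>
        rcases hs i with ⟨-, h⟩ | ⟨-, h⟩
        · rw [h, pow_succ]
          nlinarith
        · have hn := hneg i h
          rcases neg_one_pow_eq_or ℤ i with hi | hi
          · rw [hi] at ih
            linarith
          · rw [pow_succ, hi, h]
            nlinarith [hlb i]
    have := key (2 * k + 5)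
    rw [hEM, Odd.neg_one_pow ⟨k + 2, by ring⟩] at this
    linarith
  set G := Q ^ 2 * E 0 - N with hGdef
  have hGle : G ≤ K * (Q ^ 4 - 1) := by
    rw [hGdef, hN]
    nlinarith
  have hE1 : σ 1 = -1 ∧ E 1 = -Q * E 0 := by
    rcases hs 0 with ⟨h, h'⟩ | ⟨h, h'⟩
    · exact ⟨by simpa [hσ0] using h, h'⟩
    · have := hneg 0 h'
      linarith
  have hE2 : σ 2 = -1 ∧ E 2 = -G := by
    rcases hs 1 with ⟨h, h'⟩ | ⟨h, h'⟩
    · have := hub 2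
      rw [h', hE1.2] at this
      nlinarith
    · refine ⟨by rw [h, hE1.1], ?_⟩
      rw [h', hE1.2, hGdef]
      ring
  have key : ∀ i, (∃ t < i, E (t + 2 + 1) = N + Q * E (t + 2) ∧ σ (t + 2 + 1) = σ (t + 2) ∧
      E (t + 2) = -(-Q) ^ t * G ∧ σ (t + 2) = -(-1) ^ t) ∨
      (E (i + 2) = -(-Q) ^ i * G ∧ σ (i + 2) = -(-1) ^ i) := by
    intro i
    induction i with
    | zero => right; simpa using ⟨hE2.2, hE2.1⟩
    | succ i ih =>
      rcases ih with ⟨t, ht, h⟩ | ⟨h1, h2⟩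
      · exact Or.inl ⟨t, by omega, h⟩
      · rcases hs (i + 2) with ⟨h, h'⟩ | ⟨h, h'⟩
        · right
          have e : i + 1 + 2 = i + 2 + 1 := by ring
          rw [e, h, h', h1, h2]
          constructor <;> ring
        · exact Or.inl ⟨i, by omega, h', h, h1, h2⟩
  rcases key (2 * k + 3) with ⟨t, ht, hBE, hBσ, hE, hσ⟩ | ⟨-, h⟩
  swap
  · rw [hσM, Odd.neg_one_pow ⟨k + 1, by ring⟩] at h
    norm_num at h
  have hteven : Even t := by
    by_contra ho
    rw [Nat.not_even_iff_odd] at ho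
    have := hneg _ hBE
    rw [hE, ho.neg_pow] at this
    have : 0 < Q ^ t * G := by positivity
    linarith
  rw [hteven.neg_pow] at hE
  rw [hteven.neg_one_pow] at hσ
  rcases hteven with ⟨r, hr⟩
  rw [hE] at hBE
  -- t = 2r, r ≤ k+1
  rcases (by omega : t = 2 * k + 2 ∨ t = 2 * k ∨ t + 2 ≤ 2 * k) with rfl | rfl | hlt
  · left
    have e : 2 * k + 2 + 2 + 1 = 2 * k + 5 := by ring
    rw [e, hEM, pow_add, ← hX] at hBE
    have : (X * Q ^ 5 + 1) * (E 0 - K * (X * Q ^ 3 + 1)) = 0 := by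
      rw [hGdef, hN] at hBE
      linear_combination hBE
    have hp : (X * Q ^ 5 + 1) ≠ 0 := by positivity
    have := (mul_eq_zero.mp this).resolve_left hp
    linarith
  · right
    rw [← hX] at hBE
    have hpos : 0 < E (2 * k + 2 + 1) := by
      rw [hBE, hN]
      have : Q * (X * G) ≤ Q * (X * (K * (Q ^ 4 - 1))) := by gcongr
      have h2 : 0 < K * (1 + X * Q) := by positivity
      nlinarith
    have hA := (hs (2 * k + 2 + 1)).resolve_right (fun h => by
      have := hneg _ h.2
      linarith)
    rcases hs (2 * k + 2 + 1 + 1) with ⟨h, h'⟩ | ⟨h, h'⟩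
    · have e : 2 * k + 2 + 1 + 1 + 1 = 2 * k + 5 := by ring
      rw [e, hEM, hA.2, hBE] at h'
      have : (X * Q ^ 5 + 1) * (E 0 - K * (X * Q ^ 3 + Q ^ 2)) = 0 := by
        rw [hGdef, hN] at h'
        linear_combination h'
      have hp : (X * Q ^ 5 + 1) ≠ 0 := by positivity
      have := (mul_eq_zero.mp this).resolve_left hp
      linarith
    · have e : 2 * k + 2 + 1 + 1 + 1 = 2 * k + 5 := by ring
      rw [e, hσM, hA.1, hBσ, hσ] at h
      norm_num at h
  · exfalso
    have hle := hub (t + 2 + 1)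
    rw [hBE] at hle
    have hp : Q ^ t * Q ^ 2 ≤ X := by
      rw [hX, ← pow_add]
      exact pow_le_pow_right₀ (by linarith) hlt
    have h1 : Q ^ t * Q ^ 2 * G ≤ X * (K * (Q ^ 4 - 1)) := by
      gcongr
    have h2 : Q * (Q ^ t * G) ≤ X * (K * (Q ^ 4 - 1)) := by
      have : 0 < Q ^ t * G := by positivity
      nlinarith
    have h3 : (0:ℤ) < (X * Q ^ 5 + 1) - (X * Q ^ 3 + Q ^ 2) - X * (Q ^ 4 - 1) := by
      clear_value X
      obtain ⟨a, rfl⟩ : ∃ a, Q = a + 9 := ⟨Q - 9, by ring⟩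
      obtain ⟨b, rfl⟩ : ∃ b, X = b + 1 := ⟨X - 1, by ring⟩
      have ha : 0 ≤ a := by linarith
      have hb' : 0 ≤ b := by linarith
      ring_nf
      positivity
    have h4 := mul_pos (by linarith : 0 < K) h3
    have h5 : N + Q * (-Q ^ t * G) = N - Q * (Q ^ t * G) := by ring
    rw [h5, hN] at hle
    linarith

/-- Bounded orbit of multiplication by `q` modulo `n`, with its signed digit sequence `c`. -/
structure BOrb (q n u : ℤ) (m : ℕ) (v c : ℕ → ℤ) : Prop where
  hq : 3 ≤ q
  hn : 0 < n
  hu : (q ^ 2 + 1) * u < n * (q + 1)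
  step : ∀ j, v (j + 1) = q * v j - c j * n
  ub : ∀ j, v j ≤ u
  lb : ∀ j, -u ≤ v j
  anti : ∀ j, v (j + m) = - v j

namespace BOrb
variable {q n u : ℤ} {m : ℕ} {v c : ℕ → ℤ}

lemma neg (h : BOrb q n u m v c) : BOrb q n u m (fun j => - v j) (fun j => - c j) where
  hq := h.hq
  hn := h.hn
  hu := h.hu
  step := fun j => by have := h.step j; simp only [this]; ring
  ub := fun j => by have := h.lb j; linarith
  lb := fun j => by have := h.ub j; linarith
  anti := fun j => by have := h.anti j; simp only [this]

lemma u_nonneg (h : BOrb q n u m v c) : 0 ≤ u := by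
  have := h.ub 0
  have := h.lb 0
  linarith

lemma digit_lt (h : BOrb q n u m v c) (j : ℕ) : c j < 2 := by
  by_contra hc
  push Not at hc
  have h1 := h.step j
  have h2 := h.ub j
  have h3 := h.lb (j + 1)
  have hn := h.hn
  have hq := h.hq
  have hu := h.hu
  have h4 : 2 * n ≤ c j * n := by nlinarith
  have h5 : 2 * n ≤ (q + 1) * u := by nlinarith
  have h6 : 2 * n * (q ^ 2 + 1) ≤ (q + 1) * ((q ^ 2 + 1) * u) := by nlinarith [sq_nonneg q]
  have h7 : (q + 1) * ((q ^ 2 + 1) * u) < (q + 1) * (n * (q + 1)) := by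
    apply mul_lt_mul_of_pos_left hu; linarith
  nlinarith [mul_nonneg hn.le (sq_nonneg (q - 1))]

lemma digit (h : BOrb q n u m v c) (j : ℕ) : c j = -1 ∨ c j = 0 ∨ c j = 1 := by
  have h1 := h.digit_lt j
  have h2 := h.neg.digit_lt j
  omega

lemma anti_c (h : BOrb q n u m v c) (j : ℕ) : c (j + m) = - c j := by
  have h1 := h.step (j + m)
  have h2 := h.step j
  have e : j + m + 1 = (j + 1) + m := by ring
  rw [e, h.anti, h.anti, h2] at h1
  have : (c (j + m) + c j) * n = 0 := by linarith
  have := (mul_eq_zero.mp this).resolve_right h.hn.ne'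
  linarith

lemma no11 (h : BOrb q n u m v c) (j : ℕ) (hj : c j = 1) : c (j + 1) ≠ 1 := by
  intro hj'
  have h1 := h.step j
  have h2 := h.step (j + 1)
  rw [hj] at h1
  rw [hj', h1] at h2
  have h3 := h.lb (j + 1 + 1)
  have h4 := h.ub j
  have hu := h.hu
  have hq := h.hq
  nlinarith [mul_nonneg (sq_nonneg q) (by linarith : 0 ≤ u - v j)]

lemma no11' (h : BOrb q n u m v c) (j : ℕ) (hj : c j = -1) : c (j + 1) ≠ -1 := by
  have := h.neg.no11 j (by simp [hj])
  omega

lemma c_zero (h : BOrb q n u m v c) (h0 : v 0 = u) (hu : 0 < u) : c 0 = 1 := by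
  have h1 := h.step 0
  have h2 := h.ub (0 + 1)
  have hq := h.hq
  have hn := h.hn
  rw [h0] at h1
  rcases h.digit 0 with hc | hc | hc
  · rw [hc] at h1; nlinarith
  · rw [hc] at h1; nlinarith
  · exact hc

lemma no10 (h : BOrb q n u m v c) (hle : u * (q + 1) ≤ n) (j : ℕ) (hj : c j = 1) :
    c (j + 1) = -1 := by
  rcases h.digit (j + 1) with hc | hc | hc
  · exact hc
  · exfalso
    have h1 := h.step j
    have h2 := h.step (j + 1)
    rw [hj] at h1
    rw [hc, h1] at h2
    have h3 := h.lb (j + 1 + 1)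
    have h4 := h.ub j
    have hq := h.hq
    have hn := h.hn
    have h5 : n * q ≤ (q ^ 2 + 1) * u := by
      nlinarith [mul_nonneg (sq_nonneg q) (by linarith : 0 ≤ u - v j)]
    have h6 : n * q * (q + 1) ≤ (q ^ 2 + 1) * u * (q + 1) :=
      mul_le_mul_of_nonneg_right h5 (by linarith)
    have h7 : (q ^ 2 + 1) * (u * (q + 1)) ≤ (q ^ 2 + 1) * n :=
      mul_le_mul_of_nonneg_left hle (by positivity)
    nlinarith
  · exact absurd hc (h.no11 j hj)

lemma c_one (h : BOrb q n u m v c) (hm : Even m) (h0 : v 0 = u) (hu : 0 < u) : c 1 = 0 := by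
  have hc0 := h.c_zero h0 hu
  rcases h.digit 1 with hc | hc | hc
  · exfalso
    have h1 := h.step 0
    have h2 := h.step (0 + 1)
    rw [hc0, h0] at h1
    rw [h1] at h2
    simp only [zero_add] at h2
    rw [hc] at h2
    have h3 := h.ub (1 + 1)
    have hq := h.hq
    have hle : u * (q + 1) ≤ n := by
      have : (q - 1) * (u * (q + 1)) ≤ (q - 1) * n := by nlinarith
      exact le_of_mul_le_mul_left this (by linarith)
    have key : ∀ j, c j = (-1) ^ j := by
      intro j
      induction j with
      | zero => simpa using hc0
      | succ j ih =>
        rcases neg_one_pow_eq_or ℤ j with hi | hi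
        · rw [pow_succ, hi, h.no10 hle j (by rw [ih, hi])]; norm_num
        · have := h.neg.no10 hle j (by simp only [ih, hi]; norm_num)
          rw [pow_succ, hi]; linarith
    have h4 := h.anti_c 0
    rw [zero_add, key m, hm.neg_one_pow, hc0] at h4
    norm_num at h4
  · exact hc
  · exact absurd hc (h.no11 0 hc0)

set_option maxHeartbeats 1000000 in
lemma six_aux (h : BOrb q n u 6 v c) (hn : n = q ^ 6 + 1) (hu4 : u ≤ q ^ 5 - q ^ 2 + 1) (j : ℕ)
    (hj : c j = 1) (hj1 : c (j + 1) = 0) : c (j + 2) = -1 ∨ u = q ^ 5 - q ^ 2 + 1 := by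
  have hq := h.hq
  have s0 := h.step j
  have s1 := h.step (j + 1)
  have s2 := h.step (j + 2)
  have s3 := h.step (j + 3)
  have s4 := h.step (j + 4)
  have s5 := h.step (j + 5)
  rw [h.anti j] at s5
  rw [hj] at s0
  rw [hj1] at s1
  have hx := h.ub j
  have hpos3 : 0 < q ^ 3 := by positivity
  obtain ⟨a, rfl⟩ : ∃ a, q = a + 3 := ⟨q - 3, by ring⟩
  have ha : 0 ≤ a := by linarith
  have b2 : v (j + 2) ≤ -((a+3) ^ 4 - (a+3) ^ 2 + (a+3)) := by
    have : (a+3) ^ 2 * v j ≤ (a+3) ^ 2 * ((a+3) ^ 5 - (a+3) ^ 2 + 1) := by gcongr; linarith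
    rw [s1, s0, hn]
    nlinarith
  have b2' : v (j + 2) < 0 := by
    have : 0 < ((a+3) ^ 4 - (a+3) ^ 2 + (a+3)) := by ring_nf; positivity
    linarith
  have hnn := h.hn
  have hu2 : u < n := by
    rw [hn]
    have : 0 < (a+3)^6 + 1 - ((a+3) ^ 5 - (a+3) ^ 2 + 1) := by ring_nf; positivity
    linarith
  rcases h.digit (j + 2) with hc | hc | hc
  · exact Or.inl hc
  · right
    rw [hc] at s2
    have b3 : v (j + 3) ≤ -((a+3) ^ 5 - (a+3) ^ 3 + (a+3) ^ 2) := by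
      rw [s2]; nlinarith
    have b3' : v (j + 3) < 0 := by
      have : 0 < ((a+3) ^ 5 - (a+3) ^ 3 + (a+3) ^ 2) := by ring_nf; positivity
      linarith
    have hc3 : c (j + 3) = -1 := by
      have l4 := h.lb (j + 3 + 1)
      have b4 : (a + 3) * v (j + 3) ≤ -((a+3) * ((a+3) ^ 5 - (a+3) ^ 3 + (a+3) ^ 2)) := by
        nlinarith
      have : 0 < (a+3) * ((a+3) ^ 5 - (a+3) ^ 3 + (a+3) ^ 2) - ((a+3) ^ 5 - (a+3) ^ 2 + 1) := by
        ring_nf; positivity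
      rcases h.digit (j + 3) with hc | hc | hc
      · exact hc
      · rw [hc] at s3; linarith
      · rw [hc] at s3; linarith
    rw [hc3] at s3
    have b4 : v (j + 4) ≤ (a+3) ^ 4 - (a+3) ^ 3 + 1 := by
      rw [s3, hn]
      have b4 : (a + 3) * v (j + 3) ≤ -((a+3) * ((a+3) ^ 5 - (a+3) ^ 3 + (a+3) ^ 2)) := by
        nlinarith
      linarith
    have hc4 : c (j + 4) = 0 := by
      rcases h.digit (j + 4) with hc | hc | hc
      · exact absurd hc (h.no11' (j + 3) hc3)
      · exact hc
      · have l5 := h.lb (j + 4 + 1)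
        rw [hc] at s4
        have h8 : (a + 3) * v (j + 4) ≤ (a + 3) * ((a+3) ^ 4 - (a+3) ^ 3 + 1) := by gcongr
        have h9 : (0:ℤ) < (a+3) ^ 6 + 1 - (a + 3) * ((a+3) ^ 4 - (a+3) ^ 3 + 1)
          - ((a+3) ^ 5 - (a+3) ^ 2 + 1) := by ring_nf; positivity
        linarith
    rw [hc4] at s4
    have hvj : v j = (a+3)^5 - (a+3)^2 + c (j + 5) := by
      have s0' : v (j + 1) = (a + 3) * v j - n := by linarith
      have s1' : v (j + 2) = (a + 3) * v (j + 1) := by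
        have : v (j + 2) = v (j + 1 + 1) := rfl
        linarith
      have s2' : v (j + 3) = (a + 3) * v (j + 2) := by
        have : v (j + 3) = v (j + 2 + 1) := rfl
        linarith
      have s3' : v (j + 4) = (a + 3) * v (j + 3) + n := by
        have : v (j + 4) = v (j + 3 + 1) := rfl
        linarith
      have s4' : v (j + 5) = (a + 3) * v (j + 4) := by
        have : v (j + 5) = v (j + 4 + 1) := rfl
        linarith
      rw [s4', s3', s2', s1', s0'] at s5
      have : n * (v j - ((a+3)^5 - (a+3)^2 + c (j + 5))) = 0 := by
        rw [hn] at s5 ⊢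
        linear_combination -s5
      have := (mul_eq_zero.mp this).resolve_left hnn.ne'
      linarith
    have hv3 : v (j + 3) = -((a+3)^5 + (a+3)^2) + c (j + 5) * (a+3)^3 := by
      have s1' : v (j + 2) = (a + 3) * v (j + 1) := by
        have : v (j + 2) = v (j + 1 + 1) := rfl
        linarith
      have s2' : v (j + 3) = (a + 3) * v (j + 2) := by
        have : v (j + 3) = v (j + 2 + 1) := rfl
        linarith
      rw [s2', s1', s0, hvj, hn]
      ring
    have l3 := h.lb (j + 3)
    have h10 : (0:ℤ) < ((a+3)^5 + (a+3)^2) - ((a+3) ^ 5 - (a+3) ^ 2 + 1) := by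
      ring_nf; positivity
    have h11 : (0:ℤ) < (a+3)^3 := by positivity
    rcases h.digit (j + 5) with hc | hc | hc
    · rw [hc] at hv3; linarith
    · rw [hc] at hv3; linarith
    · rw [hc] at hvj; linarith
  · exfalso
    have l3 := h.lb (j + 2 + 1)
    rw [hc] at s2
    nlinarith

lemma six_aux' (h : BOrb q n u 6 v c) (hn : n = q ^ 6 + 1) (hu4 : u ≤ q ^ 5 - q ^ 2 + 1) (j : ℕ)
    (hj : c j = -1) (hj1 : c (j + 1) = 0) : c (j + 2) = 1 ∨ u = q ^ 5 - q ^ 2 + 1 := by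
  have := h.neg.six_aux hn hu4 j (by simp [hj]) (by simp [hj1])
  omega

lemma six (h : BOrb q n u 6 v c) (hn : n = q ^ 6 + 1) (hu4 : u ≤ q ^ 5 - q ^ 2 + 1)
    (h0 : v 0 = u) (hu : 0 < u) :
    u = q ^ 5 - q ^ 3 + q ∨ u = q ^ 5 - q ^ 3 + q ^ 2 - q + 1 ∨ u = q ^ 5 - q ^ 2 + 1 := by
  by_cases hne : u = q ^ 5 - q ^ 2 + 1
  · exact Or.inr (Or.inr hne)
  have c0 := h.c_zero h0 hu
  have c1 := h.c_one (by decide) h0 hu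
  have c6 := h.anti_c 0
  have c7 := h.anti_c 1
  rw [c0] at c6
  rw [c1] at c7
  have r : ∀ j, c j = 1 → c (j + 1) = 0 → c (j + 2) = -1 := fun j h1 h2 =>
    (h.six_aux hn hu4 j h1 h2).resolve_right hne
  have r' : ∀ j, c j = -1 → c (j + 1) = 0 → c (j + 2) = 1 := fun j h1 h2 =>
    (h.six_aux' hn hu4 j h1 h2).resolve_right hne
  have c2 : c 2 = -1 := r 0 c0 c1
  have val : u = q ^ 5 * c 0 + q ^ 4 * c 1 + q ^ 3 * c 2 + q ^ 2 * c 3 + q * c 4 + c 5 := by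
    have s0 : v 1 = _ := h.step 0
    have s1 : v 2 = _ := h.step 1
    have s2 : v 3 = _ := h.step 2
    have s3 : v 4 = _ := h.step 3
    have s4 : v 5 = _ := h.step 4
    have s5 : v 6 = _ := h.step 5
    have s6 : v 6 = _ := h.anti 0
    rw [s5, s4, s3, s2, s1, s0, h0] at s6
    have : n * (u - (q ^ 5 * c 0 + q ^ 4 * c 1 + q ^ 3 * c 2 + q ^ 2 * c 3 + q * c 4 + c 5)) = 0 := by
      rw [hn] at s6 ⊢
      linear_combination s6
    have := (mul_eq_zero.mp this).resolve_left h.hn.ne'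
    linarith
  have d3 := h.digit 3
  have d4 := h.digit 4
  have d5 := h.digit 5
  have n2 : c 3 ≠ -1 := h.no11' 2 c2
  have n3 := h.no11 3
  have n4 := h.no11' 4
  have n4' := h.no11 4
  have n5 := h.no11' 5
  have r2 := r' 2 c2
  have r3 := r 3
  have r4 := r' 4
  have r4' := r 4
  norm_num at *
  have n3 : c 3 = 1 → c 4 ≠ 1 := n3
  rcases d3 with d | d | d
  · exact absurd d n2
  · have c4 := r2 d
    have c5 : c 5 = 0 := by
      rcases d5 with e | e | e
      · exact absurd c6 (n5 e)
      · exact e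
      · exact absurd e (n4' c4)
    left
    rw [val, c0, c1, c2, d, c4, c5]; ring
  · rcases d4 with e | e | e
    · rcases d5 with f | f | f
      · exact absurd f (n4 e)
      · have := r4 e f
        omega
      · right; left
        rw [val, c0, c1, c2, d, e, f]; ring
    · have := r3 d e
      exact absurd c6 (n5 this)
    · exact absurd e (n3 d)

lemma block (h : BOrb q n u m v c) (hE0 : 0 ≤ (q ^ 2 + 1) * u - n * q)
    (I2 : (q ^ 5 + 1) * ((q ^ 2 + 1) * u - n * q) < n * q ^ 2 * (q - 1)) (j : ℕ) (hj : c j = 1)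
    (hE : - q ^ 2 * ((q ^ 2 + 1) * u - n * q) ≤ (q ^ 2 + 1) * v j - n * q) :
    (c (j + 1) = 0 ∧ c (j + 2) = -1) ∨ (c (j + 1) = -1 ∧ c (j + 2) = 1) := by
  have hq := h.hq
  have hn := h.hn
  have s0 := h.step j
  have s1 := h.step (j + 1)
  have s2 := h.step (j + 2)
  have hx := h.ub j
  rw [hj] at s0
  rw [s0] at s1
  have e2 : v (j + 2) = v (j + 1 + 1) := rfl
  rw [← e2] at s1
  set e := (q ^ 2 + 1) * u - n * q with he
  rcases h.digit (j + 1) with hc | hc | hc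
  · right
    refine ⟨hc, ?_⟩
    by_contra hne
    have hd : c (j + 2) ≤ 0 := by
      rcases h.digit (j + 2) with hc | hc | hc
      · omega
      · omega
      · exact absurd hc hne
    rw [hc] at s1
    have hb : q * v (j + 2) ≤ u := by
      have := h.ub (j + 2 + 1)
      nlinarith
    have h1 : (q ^ 2 + 1) * v (j + 2) = q ^ 2 * ((q ^ 2 + 1) * v j - n * q) + n * (q ^ 2 - q + 1) := by
      rw [s1]; ring
    have h2 : (q ^ 2 + 1) * (q * v (j + 2)) ≤ (q ^ 2 + 1) * u := by gcongr
    have h3 : q ^ 3 * (- q ^ 2 * e) ≤ q ^ 3 * ((q ^ 2 + 1) * v j - n * q) := by gcongr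
    nlinarith
  · left
    refine ⟨hc, ?_⟩
    by_contra hne
    have hd : 0 ≤ c (j + 2) := by
      rcases h.digit (j + 2) with hc | hc | hc
      · exact absurd hc hne
      · omega
      · omega
    rw [hc] at s1
    have hb : -u ≤ q * v (j + 2) := by
      have := h.lb (j + 2 + 1)
      nlinarith
    have h1 : (q ^ 2 + 1) * v (j + 2) = q ^ 2 * ((q ^ 2 + 1) * v j - n * q) - n * q := by
      rw [s1]; ring
    have h2 : (q ^ 2 + 1) * (-u) ≤ (q ^ 2 + 1) * (q * v (j + 2)) := by gcongr
    have h3 : q ^ 3 * ((q ^ 2 + 1) * v j - n * q) ≤ q ^ 3 * e := by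
      rw [he]; gcongr
    have h4 : q * (n * (q * (q - 1))) ≤ q * ((q ^ 3 + 1) * e) := by
      apply mul_le_mul_of_nonneg_left _ (by linarith)
      nlinarith
    have h5 : q * ((q ^ 3 + 1) * e) ≤ (q ^ 5 + 1) * e := by
      have : q * (q ^ 3 + 1) ≤ q ^ 5 + 1 := by
        obtain ⟨a, rfl⟩ : ∃ a, q = a + 3 := ⟨q - 3, by ring⟩
        have ha : 0 ≤ a := by linarith
        have : 0 ≤ ((a+3) ^ 5 + 1) - (a + 3) * ((a + 3) ^ 3 + 1) := by ring_nf; positivity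
        linarith
      nlinarith
    nlinarith
  · exact absurd hc (h.no11 j hj)

lemma main10 (l : ℕ) (hl : 2 ≤ l) (h : BOrb q n u (2 * (2 * l + 1)) v c)
    (hn : n = (q ^ 2) ^ (2 * l + 1) + 1)
    (hu4 : (q ^ 2 + 1) * u - n * q ≤ (q - 1) ^ 2 * ((q ^ 2) ^ (2 * l - 1) + (q ^ 2) ^ 2))
    (h0 : v 0 = u) (hu : 0 < u) :
    (q ^ 2 + 1) * u - n * q = 0 ∨
    (q ^ 2 + 1) * u - n * q = (q - 1) ^ 2 * ((q ^ 2) ^ (2 * l - 1) + 1) ∨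
    (q ^ 2 + 1) * u - n * q = (q - 1) ^ 2 * ((q ^ 2) ^ (2 * l - 1) + (q ^ 2) ^ 2) := by
  have hq := h.hq
  have hn0 := h.hn
  have c0 := h.c_zero h0 hu
  have c1 := h.c_one (by simp) h0 hu
  set e := (q ^ 2 + 1) * u - n * q with he
  have he0 : 0 ≤ e := by
    have s0 : v 1 = _ := h.step 0
    have s1 : v 2 = _ := h.step 1
    have := h.lb 2
    rw [s1, s0, c0, c1, h0] at this
    rw [he]; linarith
  rcases he0.eq_or_lt with hz | hpos
  · exact Or.inl hz.symm
  right
  have hX : ∃ X : ℤ, 1 ≤ X ∧ (q ^ 2) ^ (2 * l - 1) = X * q ^ 6 ∧ (q ^ 2) ^ (2 * l + 1) = X * q ^ 10 := by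
    refine ⟨(q ^ 2) ^ (2 * l - 4), one_le_pow₀ (by nlinarith), ?_, ?_⟩
    · rw [show 2 * l - 1 = (2 * l - 4) + 3 by omega, pow_add]; ring
    · rw [show 2 * l + 1 = (2 * l - 4) + 5 by omega, pow_add]; ring
  have I2 : (q ^ 5 + 1) * e < n * q ^ 2 * (q - 1) := by
    obtain ⟨X, hX1, hX2, hX3⟩ := hX
    rw [hX2] at hu4
    rw [hX3] at hn
    have h1 : (q ^ 5 + 1) * e ≤ (q ^ 5 + 1) * ((q - 1) ^ 2 * (X * q ^ 6 + (q ^ 2) ^ 2)) := by gcongr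
    have h2 : 0 < n * q ^ 2 * (q - 1) - (q ^ 5 + 1) * ((q - 1) ^ 2 * (X * q ^ 6 + (q ^ 2) ^ 2)) := by
      rw [hn]
      obtain ⟨a, ha⟩ : ∃ a, q = a + 3 := ⟨q - 3, by ring⟩
      obtain ⟨b, hb⟩ : ∃ b, X = b + 1 := ⟨X - 1, by ring⟩
      have ha' : 0 ≤ a := by linarith
      have hb' : 0 ≤ b := by linarith
      rw [ha, hb]
      ring_nf
      positivity
    linarith
  have I3 : (q ^ 4 - q ^ 2) * e ≤ (q - 1) ^ 2 * n := by
    obtain ⟨X, hX1, hX2, hX3⟩ := hX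
    rw [hX2] at hu4
    rw [hX3] at hn
    have hp : 0 ≤ q ^ 4 - q ^ 2 := by nlinarith [sq_nonneg q]
    have h1 : (q ^ 4 - q ^ 2) * e ≤ (q ^ 4 - q ^ 2) * ((q - 1) ^ 2 * (X * q ^ 6 + (q ^ 2) ^ 2)) := by
      gcongr
    have h2 : 0 < (q - 1) ^ 2 * n - (q ^ 4 - q ^ 2) * ((q - 1) ^ 2 * (X * q ^ 6 + (q ^ 2) ^ 2)) := by
      rw [hn]
      obtain ⟨a, ha⟩ : ∃ a, q = a + 3 := ⟨q - 3, by ring⟩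
      obtain ⟨b, hb⟩ : ∃ b, X = b + 1 := ⟨X - 1, by ring⟩
      have ha' : 0 ≤ a := by linarith
      have hb' : 0 ≤ b := by linarith
      rw [ha, hb]
      ring_nf
      positivity
    linarith
  -- the block invariant
  let σ : ℕ → ℤ := fun i => c (2 * i)
  let E : ℕ → ℤ := fun i => (q ^ 2 + 1) * (v (2 * i) * c (2 * i)) - n * q
  have E0 : E 0 = e := by simp [E, h0, c0, he]
  have adv : ∀ i, (c (2 * i) = 1 ∨ c (2 * i) = -1) → - q ^ 2 * e ≤ E i →
      ((c (2 * (i + 1)) = 1 ∨ c (2 * (i + 1)) = -1) ∧ - q ^ 2 * e ≤ E (i + 1)) ∧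
      ((σ (i+1) = -σ i ∧ E (i+1) = -q ^ 2 * E i) ∨
        (σ (i+1) = σ i ∧ E (i+1) = (q - 1) ^ 2 * n + q ^ 2 * E i)) := by
    intro i hc hE
    have s0 := h.step (2 * i)
    have s1 := h.step (2 * i + 1)
    have e2 : 2 * (i + 1) = 2 * i + 2 := by ring
    have e3 : 2 * i + 1 + 1 = 2 * i + 2 := by ring
    have ub := h.ub (2 * i)
    have lb := h.lb (2 * i)
    rw [e3] at s1
    simp only [σ, E, e2] at hE ⊢
    have fin : ∀ F : ℤ, F ≤ e → -q ^ 2 * e ≤ F →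
        -q ^ 2 * e ≤ -q ^ 2 * F ∧ -q ^ 2 * e ≤ (q - 1) ^ 2 * n + q ^ 2 * F := by
      intro F hF hF'
      have g1 : q ^ 2 * F ≤ q ^ 2 * e := by gcongr
      have g2 : q ^ 2 * (-q ^ 2 * e) ≤ q ^ 2 * F := by gcongr
      constructor
      · linarith
      · linarith
    rcases hc with hc | hc
    · rw [hc] at hE s0 ⊢
      have hb := h.block (by rw [← he]; exact he0) I2 (2 * i) hc (by rw [← he]; linarith)
      have hub : (q ^ 2 + 1) * (v (2 * i) * 1) - n * q ≤ e := by
        have : (q ^ 2 + 1) * (v (2 * i) * 1) ≤ (q ^ 2 + 1) * u := by gcongr; linarith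
        rw [he]; linarith
      obtain ⟨f1, f2⟩ := fin _ hub hE
      rcases hb with ⟨d1, d2⟩ | ⟨d1, d2⟩
      · rw [d1, s0] at s1
        rw [d2]
        have : (q ^ 2 + 1) * (v (2 * i + 2) * -1) - n * q
          = -q ^ 2 * ((q ^ 2 + 1) * (v (2 * i) * 1) - n * q) := by rw [s1]; ring
        rw [this]
        exact ⟨⟨by simp, f1⟩, by simp⟩
      · rw [d1, s0] at s1
        rw [d2]
        have : (q ^ 2 + 1) * (v (2 * i + 2) * 1) - n * q
          = (q - 1) ^ 2 * n + q ^ 2 * ((q ^ 2 + 1) * (v (2 * i) * 1) - n * q) := by rw [s1]; ring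
        rw [this]
        exact ⟨⟨by simp, f2⟩, by simp⟩
    · rw [hc] at hE s0 ⊢
      have hb := h.neg.block (by rw [← he]; exact he0) I2 (2 * i) (by simp [hc])
        (by rw [← he]; linarith)
      have hub : (q ^ 2 + 1) * (v (2 * i) * -1) - n * q ≤ e := by
        have : (q ^ 2 + 1) * (v (2 * i) * -1) ≤ (q ^ 2 + 1) * u := by gcongr; linarith
        rw [he]; linarith
      obtain ⟨f1, f2⟩ := fin _ hub hE
      rcases hb with ⟨d1, d2⟩ | ⟨d1, d2⟩
      · have d1' : c (2 * i + 1) = 0 := by linarith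
        have d2' : c (2 * i + 2) = 1 := by linarith
        rw [d1', s0] at s1
        rw [d2']
        have : (q ^ 2 + 1) * (v (2 * i + 2) * 1) - n * q
          = -q ^ 2 * ((q ^ 2 + 1) * (v (2 * i) * -1) - n * q) := by rw [s1]; ring
        rw [this]
        exact ⟨⟨by simp, f1⟩, by simp⟩
      · have d1' : c (2 * i + 1) = 1 := by linarith
        have d2' : c (2 * i + 2) = -1 := by linarith
        rw [d1', s0] at s1
        rw [d2']
        have : (q ^ 2 + 1) * (v (2 * i + 2) * -1) - n * q
          = (q - 1) ^ 2 * n + q ^ 2 * ((q ^ 2 + 1) * (v (2 * i) * -1) - n * q) := by rw [s1]; ring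
        rw [this]
        exact ⟨⟨by simp, f2⟩, by simp⟩
  have inv : ∀ i, (c (2 * i) = 1 ∨ c (2 * i) = -1) ∧ - q ^ 2 * e ≤ E i := by
    intro i
    induction i with
    | zero =>
      refine ⟨Or.inl c0, ?_⟩
      rw [E0]; nlinarith [sq_nonneg q]
    | succ i ih => exact (adv i ih.1 ih.2).1
  have hcM := h.anti_c 0
  have hvM := h.anti 0
  rw [zero_add, c0] at hcM
  rw [zero_add, h0] at hvM
  have := dyn_core l hl (q ^ 2) ((q - 1) ^ 2) ((q - 1) ^ 2 * n) (by nlinarith) (by nlinarith)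
    (by rw [hn]) σ E c0 hcM (by rw [E0]; simp only [E, hcM, hvM, he]; ring)
    (fun i => (adv i (inv i).1 (inv i).2).2)
    (by
      intro i
      rw [E0, he]
      simp only [E]
      have ub := h.ub (2 * i)
      have lb := h.lb (2 * i)
      have : (q ^ 2 + 1) * (v (2 * i) * c (2 * i)) ≤ (q ^ 2 + 1) * u := by
        gcongr
        rcases (inv i).1 with hc | hc <;> rw [hc] <;> linarith
      linarith)
    (by intro i; rw [E0]; exact (inv i).2) (by rw [E0]; exact hpos) (by rw [E0]; exact hu4)
  rw [E0] at this
  exact this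

end BOrb

lemma top_four (S : Finset ℕ) (a b c d : ℕ) (hab : b < a) (hbc : c < b) (hcd : d < c)
    (ha : a ∈ S) (hb : b ∈ S) (hc : c ∈ S) (hd : d ∈ S)
    (hall : ∀ x ∈ S, d ≤ x → x = a ∨ x = b ∨ x = c ∨ x = d) :
    ((S.sort (· ≤ ·)).reverse).getD 2 0 = c ∧ ((S.sort (· ≤ ·)).reverse).getD 3 0 = d := by
  set T := S.filter (· < d) with hT
  have hTlt : ∀ x ∈ T.sort (· ≤ ·), x < d := by
    intro x hx
    rw [Finset.mem_sort, hT, Finset.mem_filter] at hx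
    exact hx.2
  have hnd : (T.sort (· ≤ ·) ++ [d, c, b, a]).Nodup := by
    rw [List.nodup_append]
    refine ⟨Finset.sort_nodup _ _, by simp; omega, ?_⟩
    intro x hx y hy
    have := hTlt x hx
    simp at hy
    omega
  have hpw : (T.sort (· ≤ ·) ++ [d, c, b, a]).Pairwise (· ≤ ·) := by
    rw [List.pairwise_append]
    refine ⟨Finset.pairwise_sort _ _, by simp; omega, ?_⟩
    intro x hx y hy
    have := hTlt x hx
    simp at hy
    omega
  have hS : (T.sort (· ≤ ·) ++ [d, c, b, a]).toFinset = S := by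
    ext x
    simp only [List.toFinset_append, Finset.mem_union, List.mem_toFinset, Finset.mem_sort, hT,
      Finset.mem_filter, List.mem_cons, List.not_mem_nil, or_false]
    constructor
    · rintro (h | rfl | rfl | rfl | rfl)
      · exact h.1
      all_goals assumption
    · intro hx
      by_cases h : x < d
      · exact Or.inl ⟨hx, h⟩
      · have := hall x hx (by omega)
        omega
  have hsort := (List.toFinset_sort (· ≤ ·) hnd).mpr hpw
  rw [hS] at hsort
  rw [hsort]
  simp

section coset
variable {q m n : ℕ}

lemma q_pow_two_m (hn : n = q ^ m + 1) : (q : ZMod n) ^ (2 * m) = 1 := by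
  have h : ((q ^ m + 1 : ℕ) : ZMod n) = 0 := by rw [← hn]; simp
  push_cast at h
  have : (q : ZMod n) ^ m = -1 := by linear_combination h
  rw [mul_comm, pow_mul, this]; norm_num

lemma order_pos (hn : n = q ^ m + 1) (hm : 0 < m) : 0 < orderOf (q : ZMod n) :=
  Nat.pos_of_dvd_of_pos (orderOf_dvd_of_pow_eq_one (q_pow_two_m hn)) (by omega)

lemma mem_leaders (hn : n = q ^ m + 1) (hm : 0 < m) (s : ℕ) :
    s ∈ cosetLeaders q n ↔ s < n ∧ ∀ j, s ≤ s * q ^ j % n := by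
  have hord := order_pos hn hm
  unfold cosetLeaders cycCoset
  simp only [Finset.mem_filter, Finset.mem_range, Finset.mem_image]
  constructor
  · rintro ⟨h1, -, h3⟩
    refine ⟨h1, fun j => ?_⟩
    have := h3 (s * q ^ (j % orderOf (q : ZMod n)) % n) ⟨_, Nat.mod_lt _ hord, rfl⟩
    have e : s * q ^ (j % orderOf (q : ZMod n)) % n = s * q ^ j % n := by
      rw [← ZMod.natCast_eq_natCast_iff']
      push_cast
      rw [pow_mod_orderOf]
    rwa [e] at this
  · rintro ⟨h1, h2⟩
    refine ⟨h1, ⟨0, hord, by simp [Nat.mod_eq_of_lt h1]⟩, ?_⟩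
    rintro x ⟨j, -, rfl⟩
    exact h2 j

lemma res_eq {H s : ℕ} {u w : ℤ} {j : ℕ} (hq : Odd q) (hH : n = 2 * H) (hs : (s : ℤ) = H - u)
    (huH : u < H) (hd : (n : ℤ) ∣ w - q ^ j * u) (hw : |w| ≤ u) :
    ((s * q ^ j % n : ℕ) : ℤ) = H - w := by
  rw [abs_le] at hw
  push_cast
  have h1 : ((s : ℤ) * q ^ j) % n = (H - w) % n := by
    rw [Int.emod_eq_emod_iff_emod_sub_eq_zero]
    apply Int.emod_eq_zero_of_dvd
    obtain ⟨k, hk⟩ : ∃ k : ℤ, (q : ℤ) ^ j = 2 * k + 1 := by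
      have : Odd ((q : ℤ) ^ j) := (by exact_mod_cast hq : Odd (q : ℤ)).pow
      exact this
    obtain ⟨t, ht⟩ := hd
    have hH' : (n : ℤ) = 2 * H := by exact_mod_cast hH
    refine ⟨k + t, ?_⟩
    rw [hs]
    linear_combination ht + (H : ℤ) * hk - k * hH'
  rw [h1]
  have hH' : (n : ℤ) = 2 * H := by exact_mod_cast hH
  exact Int.emod_eq_of_lt (by linarith) (by linarith)

lemma orb_ext (hn : n = q ^ m + 1) {u w : ℤ} {j : ℕ} (hd : (n : ℤ) ∣ w - q ^ j * u) :
    (n : ℤ) ∣ (-w) - q ^ (j + m) * u := by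
  obtain ⟨t, ht⟩ := hd
  refine ⟨-t - q ^ j * u, ?_⟩
  have hn' : (n : ℤ) = q ^ m + 1 := by exact_mod_cast hn
  rw [pow_add]
  linear_combination -ht + (q : ℤ) ^ j * u * hn'

lemma orb_all (hn : n = q ^ m + 1) (hm : 0 < m) {u : ℤ}
    (hw : ∀ r < m, ∃ w : ℤ, (n : ℤ) ∣ w - q ^ r * u ∧ |w| ≤ u) (j : ℕ) :
    ∃ w : ℤ, (n : ℤ) ∣ w - q ^ j * u ∧ |w| ≤ u := by
  induction j using Nat.strong_induction_on with
  | _ j ih =>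
    by_cases hj : j < m
    · exact hw j hj
    · obtain ⟨w, h1, h2⟩ := ih (j - m) (by omega)
      refine ⟨-w, ?_, by rwa [abs_neg]⟩
      have := orb_ext hn h1
      rwa [Nat.sub_add_cancel (by omega)] at this

lemma leader_of_orb (hn : n = q ^ m + 1) (hm : 0 < m) (hq : Odd q) {H s : ℕ} {u : ℤ}
    (hH : n = 2 * H) (hs : (s : ℤ) = H - u) (huH : u < H)
    (hw : ∀ r < m, ∃ w : ℤ, (n : ℤ) ∣ w - q ^ r * u ∧ |w| ≤ u) : s ∈ cosetLeaders q n := by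
  have hu : 0 ≤ u := by
    obtain ⟨w, -, h⟩ := hw 0 hm
    exact (abs_nonneg w).trans h
  rw [mem_leaders hn hm]
  refine ⟨by omega, fun j => ?_⟩
  obtain ⟨w, h1, h2⟩ := orb_all hn hm hw j
  have := res_eq hq hH hs huH h1 h2
  have := (abs_le.mp h2).2
  omega

lemma card_of_orb (hn : n = q ^ m + 1) (hm : 0 < m) (hq : Odd q) {H s : ℕ} {u : ℤ}
    (hH : n = 2 * H) (hs : (s : ℤ) = H - u) (hu0 : 0 < u) (huH : u < H)
    (hw : ∀ r, 0 < r → r < m → ∃ w : ℤ, (n : ℤ) ∣ w - q ^ r * u ∧ |w| < u) :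
    (cycCoset q n s).card = 2 * m := by
  have hne : ∀ j, 0 < j → j < 2 * m → s * q ^ j % n ≠ s := by
    intro j hj0 hj he
    have fin : ∀ w : ℤ, (n : ℤ) ∣ w - q ^ j * u → |w| ≤ u → w = u := by
      intro w h1 h2
      have := res_eq hq hH hs huH h1 h2
      omega
    rcases lt_trichotomy j m with h | h | h
    · obtain ⟨w, h1, h2⟩ := hw j hj0 h
      have := fin w h1 h2.le
      rw [this, abs_of_pos hu0] at h2
      exact lt_irrefl _ h2
    · have h1 : (n : ℤ) ∣ (-u) - q ^ j * u := by
        have := orb_ext (j := 0) (u := u) (w := u) hn (by simp)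
        rwa [zero_add, ← h] at this
      have := fin (-u) h1 (by rw [abs_neg, abs_of_pos hu0])
      linarith
    · obtain ⟨w, h1, h2⟩ := hw (j - m) (by omega) (by omega)
      have h1 := orb_ext hn h1
      rw [Nat.sub_add_cancel (by omega)] at h1
      have := fin (-w) h1 (by rw [abs_neg]; exact h2.le)
      rw [← abs_neg, this, abs_of_pos hu0] at h2
      exact lt_irrefl _ h2
  have hsn : s < n := by omega
  have hdvd := orderOf_dvd_of_pow_eq_one (q_pow_two_m hn)
  have hord : orderOf (q : ZMod n) = 2 * m := by
    by_contra hc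
    have hlt := lt_of_le_of_ne (Nat.le_of_dvd (by omega) hdvd) hc
    apply hne _ (order_pos hn hm) hlt
    have : s * q ^ (orderOf (q : ZMod n)) % n = s % n := by
      rw [← ZMod.natCast_eq_natCast_iff']
      push_cast
      rw [pow_orderOf_eq_one, mul_one]
    rw [this, Nat.mod_eq_of_lt hsn]
  unfold cycCoset
  rw [hord, Finset.card_image_of_injOn, Finset.card_range]
  have key : ∀ i j, i < j → j < 2 * m → s * q ^ i % n ≠ s * q ^ j % n := by
    intro i j hij hj he
    apply hne (j - i) (by omega) (by omega)
    have hun : IsUnit ((q : ZMod n) ^ i) := by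
      apply IsUnit.pow
      exact IsUnit.of_pow_eq_one (q_pow_two_m hn) (by omega)
    have : s * q ^ (j - i) % n = s % n := by
      rw [← ZMod.natCast_eq_natCast_iff'] at he ⊢
      push_cast at he ⊢
      apply hun.mul_left_inj.mp
      rw [he, mul_assoc, ← pow_add, Nat.sub_add_cancel hij.le]
    rw [this, Nat.mod_eq_of_lt hsn]
  intro i hi j hj he
  simp only [Finset.coe_range, Set.mem_Iio] at hi hj
  rcases lt_trichotomy i j with h | h | h
  · exact absurd he (key i j h hj)
  · exact h
  · exact absurd he.symm (key j i h hi)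

/-- From a leader to a bounded orbit. -/
lemma leader_orb (hn : n = q ^ m + 1) (hm : 0 < m) (hq : Odd q) (hq3 : 3 ≤ q) {H s : ℕ}
    (hH : n = 2 * H) (hs : s ∈ cosetLeaders q n) (hs0 : 0 < s)
    (hu : ((q : ℤ) ^ 2 + 1) * (H - s) < n * (q + 1)) :
    ∃ v c : ℕ → ℤ, BOrb q n (H - s) m v c ∧ v 0 = H - s := by
  rw [mem_leaders hn hm] at hs
  obtain ⟨hsn, hle⟩ := hs
  have hn' : (n : ℤ) = q ^ m + 1 := by exact_mod_cast hn
  have hH' : (n : ℤ) = 2 * H := by exact_mod_cast hH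
  set f : ℕ → ℕ := fun j => s * q ^ j % n with hf
  have hfd : ∀ j, (n : ℤ) ∣ f j - s * q ^ j := by
    intro j
    have := Int.emod_emod_of_dvd ((s : ℤ) * q ^ j) (dvd_refl (n : ℤ))
    rw [Int.emod_eq_emod_iff_emod_sub_eq_zero] at this
    have := Int.dvd_of_emod_eq_zero this
    simpa [hf] using this
  have hflt : ∀ j, f j < n := fun j => Nat.mod_lt _ (by omega)
  have hanti : ∀ j, (f (j + m) : ℤ) = n - f j := by
    intro j
    obtain ⟨a, ha⟩ := hfd j
    obtain ⟨b, hb⟩ := hfd (j + m)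
    have h1 : (f (j + m) : ℤ) + f j = n * (a + b + s * q ^ j) := by
      rw [pow_add] at hb
      linear_combination ha + hb - (s : ℤ) * q ^ j * hn'
    have h2 := hflt j
    have h3 := hflt (j + m)
    have h4 : s ≤ f j := hle j
    have h5 : s ≤ f (j + m) := hle (j + m)
    have hnpos : (0 : ℤ) < n := by omega
    set k := a + b + s * (q : ℤ) ^ j
    have hk1 : 0 < k := by
      by_contra hc
      push Not at hc
      have : (n : ℤ) * k ≤ 0 := by nlinarith
      omega
    have hk2 : k < 2 := by
      by_contra hc
      push Not at hc
      have : (n : ℤ) * 2 ≤ n * k := by nlinarith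
      omega
    have : k = 1 := by omega
    rw [this] at h1
    linarith
  have hstep : ∀ j, ∃ c : ℤ, (H : ℤ) - f (j + 1) = q * (H - f j) - c * n := by
    intro j
    obtain ⟨a, ha⟩ := hfd j
    obtain ⟨b, hb⟩ := hfd (j + 1)
    obtain ⟨k, hk⟩ := hq
    have hk' : (q : ℤ) = 2 * k + 1 := by exact_mod_cast hk
    refine ⟨k - q * a + b, ?_⟩
    rw [pow_succ] at hb
    linear_combination -hb + (q : ℤ) * ha - (H : ℤ) * hk' + (k : ℤ) * hH'
  choose c hc using hstep
  refine ⟨fun j => (H : ℤ) - f j, c, ⟨by exact_mod_cast hq3, by omega, hu, hc, ?_, ?_, ?_⟩, ?_⟩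
  · intro j
    have h4 : s ≤ f j := hle j
    omega
  · intro j
    have h5 : s ≤ f (j + m) := hle (j + m)
    have := hanti j
    omega
  · intro j
    have := hanti j
    omega
  · simp [hf, Nat.mod_eq_of_lt hsn]

end coset

lemma orbit_bound {q n P : ℤ} (hq : 3 ≤ q) (hn : n = (q ^ 2 + 1) * P) (hP : 0 < P) (M : ℕ)
    (hM : 0 < M) (g : ℕ → ℤ) (hg0 : 0 ≤ g 0) (hC : (q - 1) * (q ^ 3 - 1) * g 0 < P)
    (hs : ∀ i, i + 1 < M → g (i + 1) = -q ^ 2 * g i ∨ g (i + 1) = P + q ^ 2 * g i)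
    (hb : ∀ i, 0 < i → i < M → -q ^ 2 * g 0 ≤ g i ∧ g i < g 0) (r : ℕ) (hr0 : 0 < r)
    (hr : r < 2 * M) :
    ∃ w : ℤ, n ∣ w - q ^ r * (P * q + (q - 1) ^ 2 * g 0) ∧ |w| < P * q + (q - 1) ^ 2 * g 0 := by
  set u := P * q + (q - 1) ^ 2 * g 0 with hu
  have key : ∀ i, i < M → ∃ s : ℤ, (s = 1 ∨ s = -1) ∧
      n ∣ s * (P * q + (q - 1) ^ 2 * g i) - q ^ (2 * i) * u := by
    intro i
    induction i with
    | zero => intro _; exact ⟨1, Or.inl rfl, by simp [hu]⟩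
    | succ i ih =>
      intro hi
      obtain ⟨s, hs1, t, ht⟩ := ih (by omega)
      rcases hs i hi with h | h
      · refine ⟨-s, by omega, q ^ 2 * t - s * q, ?_⟩
        rw [h, show 2 * (i + 1) = 2 * i + 2 by ring, pow_add]
        rw [hn] at ht ⊢
        linear_combination q ^ 2 * ht
      · refine ⟨s, hs1, q ^ 2 * t - s * (q - 1), ?_⟩
        rw [h, show 2 * (i + 1) = 2 * i + 2 by ring, pow_add]
        rw [hn] at ht ⊢
        linear_combination q ^ 2 * ht
  have hb' : ∀ i, i < M → -q ^ 2 * g 0 ≤ g i ∧ g i ≤ g 0 := by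
    intro i hi
    rcases Nat.eq_zero_or_pos i with rfl | h
    · exact ⟨by nlinarith [sq_nonneg q], le_rfl⟩
    · exact ⟨(hb i h hi).1, (hb i h hi).2.le⟩
  have hK : 0 < (q - 1) ^ 2 := by apply pow_pos; linarith
  rcases Nat.even_or_odd' r with ⟨i, rfl | rfl⟩
  · obtain ⟨s, hs1, hd⟩ := key i (by omega)
    obtain ⟨b1, b2⟩ := hb i (by omega) (by omega)
    refine ⟨_, hd, ?_⟩
    have hx : |P * q + (q - 1) ^ 2 * g i| < u := by
      rw [abs_lt, hu]
      constructor
      · have h1 : (q - 1) ^ 2 * (-q ^ 2 * g 0) ≤ (q - 1) ^ 2 * g i := by gcongr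
        have h2 : 2 * q * ((q - 1) * (q ^ 3 - 1) * g 0) < 2 * q * P := by gcongr
        have h3 : 0 ≤ 2 * q * ((q - 1) * (q ^ 3 - 1)) - (q - 1) ^ 2 * (q ^ 2 - 1) := by
          obtain ⟨a, rfl⟩ : ∃ a, q = a + 3 := ⟨q - 3, by ring⟩
          have ha : 0 ≤ a := by linarith
          ring_nf
          positivity
        have h4 := mul_nonneg h3 hg0
        linarith
      · have h1 : (q - 1) ^ 2 * g i < (q - 1) ^ 2 * g 0 := by gcongr
        linarith
    rcases hs1 with rfl | rfl
    · rwa [one_mul]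
    · rwa [neg_one_mul, abs_neg]
  · obtain ⟨s, hs1, t, ht⟩ := key i (by omega)
    obtain ⟨b1, b2⟩ := hb' i (by omega)
    refine ⟨-s * (P - q * (q - 1) ^ 2 * g i), ⟨q * t - s, ?_⟩, ?_⟩
    · rw [pow_succ]
      rw [hn] at ht ⊢
      linear_combination q * ht
    have hx : |P - q * (q - 1) ^ 2 * g i| < u := by
      rw [abs_lt, hu]
      constructor
      · have h1 : q * (q - 1) ^ 2 * g i ≤ q * (q - 1) ^ 2 * g 0 := by gcongr
        have h3 : 0 ≤ ((q - 1) * (q ^ 3 - 1)) - (q - 1) ^ 3 := by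
          obtain ⟨a, rfl⟩ : ∃ a, q = a + 3 := ⟨q - 3, by ring⟩
          have ha : 0 ≤ a := by linarith
          ring_nf
          positivity
        have h4 := mul_nonneg h3 hg0
        have h5 : 0 ≤ P * q := by positivity
        linarith
      · have h1 : q * (q - 1) ^ 2 * (-q ^ 2 * g 0) ≤ q * (q - 1) ^ 2 * g i := by gcongr
        have h2 : (q - 1) * ((q - 1) * (q ^ 3 - 1) * g 0) < (q - 1) * P := by
          apply mul_lt_mul_of_pos_left hC; linarith
        linarith
    rcases hs1 with rfl | rfl
    · rwa [neg_one_mul, abs_neg]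
    · rwa [neg_neg, one_mul]

lemma orbit2 {q n P : ℤ} (hq : 3 ≤ q) (hn : n = (q ^ 2 + 1) * P) (hP : 0 < P) (r : ℕ) :
    ∃ w : ℤ, n ∣ w - q ^ r * (P * q) ∧ |w| ≤ P * q := by
  have key : ∃ s : ℤ, (s = 1 ∨ s = -1) ∧
      (n ∣ s * (P * q) - q ^ r * (P * q) ∨ n ∣ s * P - q ^ r * (P * q)) := by
    induction r with
    | zero => exact ⟨1, Or.inl rfl, Or.inl (by simp)⟩
    | succ r ih =>
      obtain ⟨s, hs, ⟨t, ht⟩ | ⟨t, ht⟩⟩ := ih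
      · refine ⟨-s, by omega, Or.inr ⟨q * t - s, ?_⟩⟩
        rw [pow_succ]
        rw [hn] at ht ⊢
        linear_combination q * ht
      · refine ⟨s, hs, Or.inl ⟨q * t, ?_⟩⟩
        rw [pow_succ]
        linear_combination q * ht
  have h1 : 0 < P * q := by positivity
  have h2 : P ≤ P * q := by nlinarith
  obtain ⟨s, hs, h | h⟩ := key
  · refine ⟨_, h, ?_⟩
    rcases hs with rfl | rfl
    · rw [one_mul, abs_of_pos h1]
    · rw [neg_one_mul, abs_neg, abs_of_pos h1]
  · refine ⟨_, h, ?_⟩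
    rcases hs with rfl | rfl
    · rwa [one_mul, abs_of_pos hP]
    · rwa [neg_one_mul, abs_neg, abs_of_pos hP]

lemma orbit3 {q n P R : ℤ} (k : ℕ) (hq : 3 ≤ q) (hn : n = (q ^ 2 + 1) * P)
    (hP : (q ^ 2 + 1) * P = (q ^ 2) ^ (2 * k + 3) + 1)
    (hR : (q ^ 2 + 1) * R = (q ^ 2) ^ (2 * k + 1) + 1) (r : ℕ) (hr0 : 0 < r)
    (hr : r < 2 * (2 * k + 3)) :
    ∃ w : ℤ, n ∣ w - q ^ r * (P * q + (q - 1) ^ 2 * R) ∧ |w| < P * q + (q - 1) ^ 2 * R := by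
  set Q := q ^ 2 with hQ
  have hQ9 : 9 ≤ Q := by nlinarith
  have hQ1 : 0 < Q + 1 := by linarith
  have p1 : Q ^ (2 * k + 1) = Q ^ (2 * k) * Q := by ring
  have p3 : Q ^ (2 * k + 3) = Q ^ (2 * k) * Q ^ 3 := by ring
  have hX1 : 1 ≤ Q ^ (2 * k) := one_le_pow₀ (by linarith)
  rw [p3] at hP
  rw [p1] at hR
  have hPpos : 0 < P := by
    have : 0 < (Q + 1) * P := by rw [hP]; positivity
    exact pos_of_mul_pos_right this hQ1.le
  have hRpos : 0 < R := by
    have : 0 < (Q + 1) * R := by rw [hR]; positivity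
    exact pos_of_mul_pos_right this hQ1.le
  let g : ℕ → ℤ := fun i => if i = 0 then R else if i = 1 then -Q * R else (-Q) ^ (i - 2) * (1 - Q)
  have g0 : g 0 = R := rfl
  have g1 : g 1 = -Q * R := rfl
  have g2 : ∀ t, g (t + 2) = (-Q) ^ t * (1 - Q) := by
    intro t
    simp [g]
  have := orbit_bound hq hn hPpos (2 * k + 3) (by omega) g (by rw [g0]; exact hRpos.le) ?_ ?_ ?_ r hr0 hr
  · rwa [g0] at this
  · rw [g0]
    have h : (Q + 1) * ((q - 1) * (q ^ 3 - 1) * R) < (Q + 1) * P := by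
      rw [hP, show (Q + 1) * ((q - 1) * (q ^ 3 - 1) * R) = (q - 1) * (q ^ 3 - 1) * ((Q + 1) * R) by ring,
        hR]
      generalize Q ^ (2 * k) = X at *
      rw [← sub_pos, hQ]
      clear_value Q
      clear hP hR hQ g2 g1 g0 g p1 p3
      obtain ⟨a, rfl⟩ : ∃ a, q = a + 3 := ⟨q - 3, by ring⟩
      obtain ⟨b, rfl⟩ : ∃ b, X = b + 1 := ⟨X - 1, by ring⟩
      have ha : 0 ≤ a := by linarith
      have hb' : 0 ≤ b := by linarith
      ring_nf
      positivity
    exact lt_of_mul_lt_mul_left h hQ1.le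
  · intro i hi
    rcases i with _ | _ | i
    · left; exact g1
    · right
      have h2 := g2 0
      simp only [zero_add, pow_zero, one_mul] at h2 ⊢
      show g 2 = _
      rw [h2, g1]
      apply mul_left_cancel₀ hQ1.ne'
      linear_combination Q ^ 2 * hR - hP
    · left
      have h2 := g2 (i + 1)
      have h1 := g2 i
      show g (i + 1 + 2) = _ * g (i + 2)
      rw [h2, h1, pow_succ]
      ring
  · intro i hi0 hi
    rcases i with _ | _ | t
    · omega
    · rw [zero_add, g1, g0]
      exact ⟨le_rfl, by nlinarith⟩
    · rw [show t + 1 + 1 = t + 2 by rfl, g2, g0]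
      have hTpos : 0 < Q ^ t := by positivity
      rcases Nat.even_or_odd t with ho | ho
      · rw [ho.neg_pow]
        have hT : Q ^ t ≤ Q ^ (2 * k) := pow_le_pow_right₀ (by linarith) (by omega)
        refine ⟨?_, by nlinarith⟩
        apply le_of_mul_le_mul_left _ hQ1
        have h1 : Q ^ t * (Q ^ 2 - 1) ≤ Q ^ (2 * k) * Q ^ 2 := by
          apply mul_le_mul hT (by linarith) (by nlinarith) (by positivity)
        have : (Q + 1) * (-Q * R) = -Q * (Q ^ (2 * k) * Q + 1) := by rw [← hR]; ring
        rw [this]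
        linarith
      · rw [ho.neg_pow]
        have hT : Q ^ (t + 1) ≤ Q ^ (2 * k) := pow_le_pow_right₀ (by linarith) (by
          obtain ⟨z, hz⟩ := ho
          omega)
        rw [pow_succ] at hT
        refine ⟨by nlinarith, ?_⟩
        apply lt_of_mul_lt_mul_left _ hQ1.le
        rw [hR]
        nlinarith

lemma orbit4 {q n P S : ℤ} (k : ℕ) (hq : 3 ≤ q) (hn : n = (q ^ 2 + 1) * P)
    (hP : (q ^ 2 + 1) * P = (q ^ 2) ^ (2 * k + 5) + 1)
    (hS : (q ^ 2 + 1) * S = (q ^ 2) ^ (2 * k + 1) + 1) (r : ℕ) (hr0 : 0 < r)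
    (hr : r < 2 * (2 * k + 5)) :
    ∃ w : ℤ, n ∣ w - q ^ r * (P * q + (q - 1) ^ 2 * ((q ^ 2) ^ 2 * S)) ∧
      |w| < P * q + (q - 1) ^ 2 * ((q ^ 2) ^ 2 * S) := by
  set Q := q ^ 2 with hQ
  have hQ9 : 9 ≤ Q := by nlinarith
  have hQ1 : 0 < Q + 1 := by linarith
  have p1 : Q ^ (2 * k + 1) = Q ^ (2 * k) * Q := by ring
  have p5 : Q ^ (2 * k + 5) = Q ^ (2 * k) * Q ^ 5 := by ring
  have hX1 : 1 ≤ Q ^ (2 * k) := one_le_pow₀ (by linarith)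
  rw [p5] at hP
  rw [p1] at hS
  have hPpos : 0 < P := by
    have : 0 < (Q + 1) * P := by rw [hP]; positivity
    exact pos_of_mul_pos_right this hQ1.le
  have hSpos : 0 < S := by
    have : 0 < (Q + 1) * S := by rw [hS]; positivity
    exact pos_of_mul_pos_right this hQ1.le
  let g : ℕ → ℤ := fun i => if i = 0 then Q ^ 2 * S else if i = 1 then -Q * (Q ^ 2 * S) else
    if i ≤ 2 * k + 2 then (-Q) ^ (i - 2) * ((1 - Q) * (1 + Q ^ 2)) else
    if i = 2 * k + 3 then S else -Q * S
  have g0 : g 0 = Q ^ 2 * S := rfl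
  have g1 : g 1 = -Q * (Q ^ 2 * S) := rfl
  have g2 : ∀ t, t ≤ 2 * k → g (t + 2) = (-Q) ^ t * ((1 - Q) * (1 + Q ^ 2)) := by
    intro t ht
    simp [g, ht]
  have g3 : g (2 * k + 3) = S := by simp [g]
  have g4 : g (2 * k + 4) = -Q * S := by simp [g]
  have := orbit_bound hq hn hPpos (2 * k + 5) (by omega) g (by rw [g0]; positivity) ?_ ?_ ?_ r hr0 hr
  · rwa [g0] at this
  · rw [g0]
    have h : (Q + 1) * ((q - 1) * (q ^ 3 - 1) * (Q ^ 2 * S)) < (Q + 1) * P := by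
      rw [hP, show (Q + 1) * ((q - 1) * (q ^ 3 - 1) * (Q ^ 2 * S)) =
        (q - 1) * (q ^ 3 - 1) * Q ^ 2 * ((Q + 1) * S) by ring, hS]
      generalize Q ^ (2 * k) = X at *
      rw [← sub_pos, hQ]
      clear_value Q
      clear hP hS hQ g2 g1 g0 g3 g4 g p1 p5
      obtain ⟨a, rfl⟩ : ∃ a, q = a + 3 := ⟨q - 3, by ring⟩
      obtain ⟨b, rfl⟩ : ∃ b, X = b + 1 := ⟨X - 1, by ring⟩
      have ha : 0 ≤ a := by linarith
      have hb' : 0 ≤ b := by linarith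
      ring_nf
      positivity
    exact lt_of_mul_lt_mul_left h hQ1.le
  · intro i hi
    rcases i with _ | _ | i
    · left; exact g1
    · right
      have h2 := g2 0 (by omega)
      simp only [zero_add, pow_zero, one_mul] at h2 ⊢
      show g 2 = _
      rw [h2, g1]
      apply mul_left_cancel₀ hQ1.ne'
      linear_combination Q ^ 4 * hS - hP
    · rcases (by omega : i < 2 * k ∨ i = 2 * k ∨ i = 2 * k + 1) with h | rfl | rfl
      · left
        have h2 := g2 (i + 1) (by omega)
        have h1 := g2 i (by omega)
        show g (i + 1 + 2) = _ * g (i + 2)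
        rw [h2, h1, pow_succ]
        ring
      · right
        show g (2 * k + 3) = P + Q * g (2 * k + 2)
        rw [g3, g2 _ le_rfl, (even_two_mul k).neg_pow]
        apply mul_left_cancel₀ hQ1.ne'
        linear_combination hS - hP
      · left
        show g (2 * k + 4) = -Q * g (2 * k + 3)
        rw [g3, g4]
  · intro i hi0 hi
    have hQQ : 81 ≤ Q ^ 2 := by nlinarith
    rcases i with _ | _ | t
    · omega
    · rw [zero_add, g1, g0]
      refine ⟨le_rfl, ?_⟩
      have : 0 < Q ^ 2 * S := by positivity
      nlinarith
    · rw [show t + 1 + 1 = t + 2 by rfl, g0]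
      rcases (by omega : t ≤ 2 * k ∨ t = 2 * k + 1 ∨ t = 2 * k + 2) with ht | rfl | rfl
      · rw [g2 t ht]
        have hTpos : 0 < Q ^ t := by positivity
        have hfac : 0 < (Q - 1) * (1 + Q ^ 2) := by
          apply mul_pos <;> linarith
        have hfac2 := mul_pos hTpos hfac
        have hQS : 0 < Q ^ 2 * S := by positivity
        have hQS' : 0 < Q * (Q ^ 2 * S) := by positivity
        rcases Nat.even_or_odd t with ho | ho
        · rw [ho.neg_pow]
          have hT : Q ^ t ≤ Q ^ (2 * k) := pow_le_pow_right₀ (by linarith) (by omega)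
          refine ⟨?_, by linarith⟩
          apply le_of_mul_le_mul_left _ hQ1
          have h1 : Q ^ t * (Q ^ 4 - 1) ≤ Q ^ (2 * k) * Q ^ 4 := by
            apply mul_le_mul hT (by linarith) (by nlinarith) (by positivity)
          have : (Q + 1) * (-Q * (Q ^ 2 * S)) = -Q ^ 3 * (Q ^ (2 * k) * Q + 1) := by rw [← hS]; ring
          rw [this]
          have : 0 < Q ^ 3 := by positivity
          linarith
        · rw [ho.neg_pow]
          have hT : Q ^ (t + 1) ≤ Q ^ (2 * k) := pow_le_pow_right₀ (by linarith) (by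
            obtain ⟨z, hz⟩ := ho
            omega)
          rw [pow_succ] at hT
          refine ⟨by linarith, ?_⟩
          apply lt_of_mul_lt_mul_left _ hQ1.le
          have : (Q + 1) * (Q ^ 2 * S) = Q ^ 2 * (Q ^ (2 * k) * Q + 1) := by rw [← hS]; ring
          rw [this]
          have h1 : Q ^ t * Q * Q ^ 3 ≤ Q ^ (2 * k) * Q ^ 3 := by gcongr
          linarith
      · show _ ≤ g (2 * k + 3) ∧ g (2 * k + 3) < _
        rw [g3]
        have : 0 < Q * (Q ^ 2 * S) := by positivity
        constructor <;> nlinarith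
      · show _ ≤ g (2 * k + 4) ∧ g (2 * k + 4) < _
        rw [g4]
        have h1 : 0 < Q * S := by positivity
        have h2 : 0 < Q ^ 2 * S := by positivity
        constructor <;> nlinarith

lemma orbit4six {q : ℤ} (hq : 3 ≤ q) (r : ℕ) (hr0 : 0 < r) (hr : r < 6) :
    ∃ w : ℤ, (q ^ 6 + 1) ∣ w - q ^ r * (q ^ 5 - q ^ 2 + 1) ∧ |w| < q ^ 5 - q ^ 2 + 1 := by
  obtain ⟨a, rfl⟩ : ∃ a, q = a + 3 := ⟨q - 3, by ring⟩
  have ha : 0 ≤ a := by linarith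
  interval_cases r
  · refine ⟨-(a+3)^3 + (a+3) - 1, ⟨-1, by ring⟩, ?_⟩
    rw [abs_lt]; constructor <;> rw [← sub_pos] <;> ring_nf <;> positivity
  · refine ⟨-(a+3)^4 + (a+3)^2 - (a+3), ⟨-(a+3), by ring⟩, ?_⟩
    rw [abs_lt]; constructor <;> rw [← sub_pos] <;> ring_nf <;> positivity
  · refine ⟨-(a+3)^5 + (a+3)^3 - (a+3)^2, ⟨-(a+3)^2, by ring⟩, ?_⟩
    rw [abs_lt]; constructor <;> rw [← sub_pos] <;> ring_nf <;> positivity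
  · refine ⟨(a+3)^4 - (a+3)^3 + 1, ⟨-(a+3)^3+1, by ring⟩, ?_⟩
    rw [abs_lt]; constructor <;> rw [← sub_pos] <;> ring_nf <;> positivity
  · refine ⟨(a+3)^5 - (a+3)^4 + (a+3), ⟨-(a+3)^4+(a+3), by ring⟩, ?_⟩
    rw [abs_lt]; constructor <;> rw [← sub_pos] <;> ring_nf <;> positivity

lemma final_step {q m n : ℕ} (hn : n = q ^ m + 1) (hm : 0 < m) (hq : Odd q) (hq3 : 3 ≤ q)
    {H δ3 δ4 : ℕ} (hH : n = 2 * H) {u2 u3 u4 : ℤ} (h2 : 0 < u2) (h23 : u2 < u3) (h34 : u3 < u4)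
    (hu4 : ((q : ℤ) ^ 2 + 1) * u4 < n * (q + 1))
    (hw2 : ∀ r, ∃ w : ℤ, (n : ℤ) ∣ w - q ^ r * u2 ∧ |w| ≤ u2)
    (hw3 : ∀ r, 0 < r → r < m → ∃ w : ℤ, (n : ℤ) ∣ w - q ^ r * u3 ∧ |w| < u3)
    (hw4 : ∀ r, 0 < r → r < m → ∃ w : ℤ, (n : ℤ) ∣ w - q ^ r * u4 ∧ |w| < u4)
    (hcl : ∀ (u : ℤ) (v c : ℕ → ℤ), BOrb q n u m v c → v 0 = u → 0 < u → u ≤ u4 →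
      u = u2 ∨ u = u3 ∨ u = u4)
    (h3 : (u3 < H → u4 < H → (δ3 : ℤ) = H - u3)) (h4 : u3 < H → u4 < H → (δ4 : ℤ) = H - u4) :
    nthLargestCosetLeader q n 3 = δ3 ∧ nthLargestCosetLeader q n 4 = δ4 ∧
    (cycCoset q n δ3).card = 2 * m ∧ (cycCoset q n δ4).card = 2 * m := by
  have hq3' : (3 : ℤ) ≤ q := by exact_mod_cast hq3
  have hn0 : (0 : ℤ) < n := by rw [hn]; positivity
  have hH' : (n : ℤ) = 2 * H := by exact_mod_cast hH
  have huH : u4 < H := by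
    by_contra hc
    push Not at hc
    have e1 : ((q : ℤ) ^ 2 + 1) * (2 * H) ≤ ((q : ℤ) ^ 2 + 1) * (2 * u4) := by
      apply mul_le_mul_of_nonneg_left _ (by positivity)
      linarith
    have e2 : (n : ℤ) * (2 * (q + 1)) ≤ n * (q ^ 2 + 1) := by
      apply mul_le_mul_of_nonneg_left _ hn0.le
      nlinarith
    rw [← hH'] at e1
    linarith
  have h3' := h3 (by linarith) huH
  have h4' := h4 (by linarith) huH
  have ext : ∀ u : ℤ, 0 < u →
      (∀ r, 0 < r → r < m → ∃ w : ℤ, (n : ℤ) ∣ w - q ^ r * u ∧ |w| < u) →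
      ∀ r < m, ∃ w : ℤ, (n : ℤ) ∣ w - q ^ r * u ∧ |w| ≤ u := by
    intro u hu h r hr
    rcases Nat.eq_zero_or_pos r with rfl | h0
    · exact ⟨u, by simp, by rw [abs_of_pos hu]⟩
    · obtain ⟨w, a, b⟩ := h r h0 hr
      exact ⟨w, a, b.le⟩
  have l1 : H ∈ cosetLeaders q n := leader_of_orb hn hm hq (u := 0) hH (by simp) (by linarith)
    (fun r _ => ⟨0, by simp, by simp⟩)
  obtain ⟨b, hb⟩ : ∃ b : ℕ, (b : ℤ) = H - u2 := ⟨(H - u2).toNat, by rw [Int.toNat_of_nonneg]; linarith⟩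
  have l2 : b ∈ cosetLeaders q n := leader_of_orb hn hm hq hH hb (by linarith) (fun r _ => hw2 r)
  have l3 : δ3 ∈ cosetLeaders q n := leader_of_orb hn hm hq hH h3' (by linarith)
    (ext u3 (by linarith) hw3)
  have l4 : δ4 ∈ cosetLeaders q n := leader_of_orb hn hm hq hH h4' (by linarith)
    (ext u4 (by linarith) hw4)
  have key := top_four (cosetLeaders q n) H b δ3 δ4 (by omega) (by omega) (by omega) l1 l2 l3 l4 (by
    intro x hx hdx
    have hxu : (H : ℤ) - x ≤ u4 := by omega
    obtain ⟨v, c, hB, hv⟩ := leader_orb hn hm hq hq3 hH hx (by omega) (by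
      refine lt_of_le_of_lt ?_ hu4
      exact mul_le_mul_of_nonneg_left hxu (by positivity))
    have hnn := hB.u_nonneg
    rcases hnn.eq_or_lt with h | h
    · left; omega
    · have := hcl _ v c hB hv h hxu
      omega)
  exact ⟨key.1, key.2, card_of_orb hn hm hq hH h3' (by linarith) (by linarith) hw3,
    card_of_orb hn hm hq hH h4' (by linarith) huH hw4⟩

lemma delta3_eq {q X H n : ℕ} {P R : ℤ} (hq3 : 3 ≤ q) (hX : 0 < X) (hn : n = X * q ^ 4 + 1)
    (hH : n = 2 * H) (hP : ((q : ℤ) ^ 2 + 1) * P = n) (hR : ((q : ℤ) ^ 2 + 1) * R = X + 1)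
    (hlt : P * q + ((q : ℤ) - 1) ^ 2 * R < H) :
    (((q - 1) ^ 2 * (X * q ^ 4 - 2 * X - 1) / (2 * (q ^ 2 + 1)) : ℕ) : ℤ) =
      H - (P * q + ((q : ℤ) - 1) ^ 2 * R) := by
  obtain ⟨d, hd⟩ : ∃ d : ℕ, (d : ℤ) = H - (P * q + ((q : ℤ) - 1) ^ 2 * R) :=
    ⟨(H - (P * q + ((q : ℤ) - 1) ^ 2 * R)).toNat, by rw [Int.toNat_of_nonneg]; linarith⟩
  rw [← hd]
  norm_cast
  apply Nat.div_eq_of_eq_mul_left (by positivity)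
  have hq4 : 81 ≤ q ^ 4 := by
    calc 81 = 3 ^ 4 := by norm_num
      _ ≤ q ^ 4 := Nat.pow_le_pow_left hq3 4
  have hle : 2 * X + 1 ≤ X * q ^ 4 := by nlinarith
  have hn' : (n : ℤ) = X * q ^ 4 + 1 := by exact_mod_cast hn
  have hH' : (n : ℤ) = 2 * H := by exact_mod_cast hH
  zify [show 1 ≤ q by omega, show 2 * X ≤ X * q ^ 4 by omega, show 1 ≤ X * q ^ 4 - 2 * X by omega]
  rw [hd]
  have : ((q : ℤ) - 1) ^ 2 * (X * q ^ 4 - 2 * X - 1) =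
      ((q : ℤ) - 1) ^ 2 * (n - 2 * (X + 1)) := by rw [hn']; ring
  rw [this, ← hR]
  linear_combination (q ^ 2 + 1) * hH' + 2 * (q : ℤ) * hP


lemma case_six {q n δ3 δ4 : ℕ} (hodd : Odd q) (hq3 : 3 ≤ q) (hn : n = q ^ 6 + 1)
    (h3 : δ3 = (q - 1) ^ 2 * (q ^ 6 - 2 * q ^ (6 - 4) - 1) / (2 * (q ^ 2 + 1)))
    (h4 : δ4 = δ3 - q * (q - 1) ^ 2) :
    nthLargestCosetLeader q n 3 = δ3 ∧ nthLargestCosetLeader q n 4 = δ4 ∧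
    (cycCoset q n δ3).card = 2 * 6 ∧ (cycCoset q n δ4).card = 2 * 6 := by
  have hq3' : (3 : ℤ) ≤ q := by exact_mod_cast hq3
  have hn' : (n : ℤ) = (q : ℤ) ^ 6 + 1 := by exact_mod_cast hn
  obtain ⟨H, hH⟩ : ∃ H, n = 2 * H := by
    have : Even n := by rw [hn]; exact (hodd.pow).add_one
    exact this.two_dvd
  have hPn : ((q : ℤ) ^ 2 + 1) * (q ^ 4 - q ^ 2 + 1) = n := by rw [hn']; ring
  have hP0 : (0 : ℤ) < (q : ℤ) ^ 4 - q ^ 2 + 1 := by nlinarith [sq_nonneg ((q : ℤ) ^ 2 - 1)]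
  have e2 : ((q : ℤ) ^ 4 - q ^ 2 + 1) * q = q ^ 5 - q ^ 3 + q := by ring
  have e3 : ((q : ℤ) ^ 4 - q ^ 2 + 1) * q + ((q : ℤ) - 1) ^ 2 * 1
      = q ^ 5 - q ^ 3 + q ^ 2 - q + 1 := by ring
  have d3 : ((q : ℤ) ^ 5 - q ^ 3 + q ^ 2 - q + 1 < H) →
      (δ3 : ℤ) = H - (q ^ 5 - q ^ 3 + q ^ 2 - q + 1) := by
    intro hlt
    rw [← e3] at hlt ⊢
    rw [h3, show q ^ 6 = q ^ 2 * q ^ 4 by ring, show 6 - 4 = 2 by norm_num]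
    exact delta3_eq hq3 (by positivity) (by rw [hn]; ring) hH hPn (by push_cast; ring) hlt
  refine final_step hn (by norm_num) hodd hq3 hH (u2 := q ^ 5 - q ^ 3 + q)
    (u3 := q ^ 5 - q ^ 3 + q ^ 2 - q + 1) (u4 := q ^ 5 - q ^ 2 + 1) ?_ ?_ ?_ ?_ ?_ ?_ ?_ ?_ ?_ ?_
  · rw [← e2]; positivity
  · nlinarith
  · have : (0 : ℤ) < q * (q - 1) ^ 2 := by
      have : (0 : ℤ) < q - 1 := by linarith
      positivity
    nlinarith
  · rw [hn']
    obtain ⟨a, ha⟩ : ∃ a : ℤ, (q : ℤ) = a + 3 := ⟨q - 3, by ring⟩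
    have ha0 : 0 ≤ a := by linarith
    rw [ha, ← sub_pos]
    ring_nf
    positivity
  · intro r
    rw [← e2]
    exact orbit2 hq3' hPn.symm hP0 r
  · intro r hr0 hr
    rw [← e3]
    exact orbit3 0 hq3' hPn.symm (by ring) (by ring) r hr0 (by omega)
  · intro r hr0 hr
    rw [hn']
    exact orbit4six hq3' r hr0 hr
  · intro u v c hB h0 hu hu4
    exact hB.six hn' hu4 h0 hu
  · intro hlt _
    exact d3 hlt
  · intro hlt hlt4
    have := d3 hlt
    have hc : ((q * (q - 1) ^ 2 : ℕ) : ℤ) = q * ((q : ℤ) - 1) ^ 2 := by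
      push_cast [Nat.cast_sub (show 1 ≤ q by omega)]
      ring
    have e : (q : ℤ) ^ 5 - q ^ 2 + 1 = (q ^ 5 - q ^ 3 + q ^ 2 - q + 1) + q * ((q : ℤ) - 1) ^ 2 := by
      ring
    rw [e] at hlt4 ⊢
    rw [h4, Nat.cast_sub (by zify; zify at hc; linarith), hc, this]
    ring

set_option maxHeartbeats 1600000 in
lemma case_big {q n δ3 δ4 j : ℕ} (hodd : Odd q) (hq3 : 3 ≤ q)
    (hn : n = q ^ (2 * (2 * (j + 2) + 1)) + 1)
    (h3 : δ3 = (q - 1) ^ 2 * (q ^ (2 * (2 * (j + 2) + 1)) - 2 * q ^ (2 * (2 * (j + 2) + 1) - 4) - 1)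
      / (2 * (q ^ 2 + 1)))
    (h4 : δ4 = δ3 - (q - 1) ^ 2 * (q ^ 2 - 1)) :
    nthLargestCosetLeader q n 3 = δ3 ∧ nthLargestCosetLeader q n 4 = δ4 ∧
    (cycCoset q n δ3).card = 2 * (2 * (2 * (j + 2) + 1)) ∧
    (cycCoset q n δ4).card = 2 * (2 * (2 * (j + 2) + 1)) := by
  have hq3' : (3 : ℤ) ≤ q := by exact_mod_cast hq3
  have hn' : (n : ℤ) = ((q : ℤ) ^ 2) ^ (2 * j + 5) + 1 := by
    rw [hn]; push_cast; rw [← pow_mul]; congr 2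
  obtain ⟨H, hH⟩ : ∃ H, n = 2 * H := by
    have : Even n := by rw [hn]; exact (hodd.pow).add_one
    exact this.two_dvd
  have dv : ∀ k : ℕ, ∃ P : ℤ, ((q : ℤ) ^ 2 + 1) * P = ((q : ℤ) ^ 2) ^ (2 * k + 1) + 1 := by
    intro k
    have h := Odd.add_dvd_pow_add_pow ((q : ℤ) ^ 2) 1 (n := 2 * k + 1) ⟨k, rfl⟩
    rw [one_pow] at h
    obtain ⟨P, hP⟩ := h
    exact ⟨P, hP.symm⟩
  obtain ⟨P, hP⟩ := dv (j + 2)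
  obtain ⟨R, hR⟩ := dv (j + 1)
  obtain ⟨S, hS⟩ := dv j
  have hQ : (0 : ℤ) < (q : ℤ) ^ 2 + 1 := by positivity
  have hPn : ((q : ℤ) ^ 2 + 1) * P = n := by rw [hP, hn']; rfl
  have hP0 : 0 < P := by
    by_contra hc
    push Not at hc
    have : ((q : ℤ) ^ 2 + 1) * P ≤ 0 := mul_nonpos_of_nonneg_of_nonpos hQ.le hc
    have : (0 : ℤ) < n := by rw [hn']; positivity
    linarith
  have hR0 : 0 < R := by
    by_contra hc
    push Not at hc
    have : ((q : ℤ) ^ 2 + 1) * R ≤ 0 := mul_nonpos_of_nonneg_of_nonpos hQ.le hc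
    have : (0 : ℤ) < ((q : ℤ) ^ 2) ^ (2 * (j + 1) + 1) + 1 := by positivity
    linarith
  have hRS : ((q : ℤ) ^ 2) ^ 2 * S = R + (q ^ 2 - 1) := by
    apply mul_left_cancel₀ hQ.ne'
    have : ((q : ℤ) ^ 2) ^ (2 * (j + 1) + 1) = ((q : ℤ) ^ 2) ^ (2 * j + 1) * ((q : ℤ) ^ 2) ^ 2 := by
      ring
    rw [this] at hR
    linear_combination ((q : ℤ) ^ 2) ^ 2 * hS - hR
  have hq1 : (0 : ℤ) < ((q : ℤ) - 1) ^ 2 := by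
    have : (0 : ℤ) < q - 1 := by linarith
    positivity
  have hq2 : (0 : ℤ) < (q : ℤ) ^ 2 - 1 := by nlinarith
  set X : ℤ := ((q : ℤ) ^ 2) ^ (2 * (j + 1) + 1) with hX
  have hXn : (n : ℤ) = X * q ^ 4 + 1 := by rw [hn', hX]; ring
  have hX6 : ((q : ℤ) ^ 2) ^ 3 ≤ X := by
    rw [hX]
    exact pow_le_pow_right₀ (by nlinarith) (by omega)
  have hX0 : 0 < X := by rw [hX]; positivity
  have d3 : P * q + ((q : ℤ) - 1) ^ 2 * R < H → (δ3 : ℤ) = H - (P * q + ((q : ℤ) - 1) ^ 2 * R) := by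
    intro hlt
    have a1 : q ^ (2 * (2 * (j + 2) + 1)) = q ^ (2 * (2 * (j + 1) + 1)) * q ^ 4 := by
      rw [← pow_add]; congr 1
    have a2 : 2 * (2 * (j + 2) + 1) - 4 = 2 * (2 * (j + 1) + 1) := by omega
    rw [h3, a2, a1]
    refine delta3_eq hq3 (by positivity) (by rw [hn, a1]) hH hPn ?_ hlt
    rw [hR, hX]; push_cast; rw [← pow_mul]
  have hl1 : 2 * (j + 2) - 1 = 2 * (j + 1) + 1 := by omega
  refine final_step hn (by omega) hodd hq3 hH (u2 := P * q)
    (u3 := P * q + ((q : ℤ) - 1) ^ 2 * R)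
    (u4 := P * q + ((q : ℤ) - 1) ^ 2 * (((q : ℤ) ^ 2) ^ 2 * S)) ?_ ?_ ?_ ?_ ?_ ?_ ?_ ?_ ?_ ?_
  · positivity
  · have := mul_pos hq1 hR0
    linarith
  · rw [hRS]
    have := mul_pos hq1 hq2
    linarith
  · have e : ((q : ℤ) ^ 2 + 1) * (P * q + ((q : ℤ) - 1) ^ 2 * (((q : ℤ) ^ 2) ^ 2 * S)) =
        n * q + ((q : ℤ) - 1) ^ 2 * (X + q ^ 4) := by
      rw [hRS]
      linear_combination q * hPn + ((q : ℤ) - 1) ^ 2 * hR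
    rw [e]
    have b1 : ((q : ℤ) - 1) ^ 2 * (X + q ^ 4) ≤ q ^ 2 * (X + q ^ 4) := by
      apply mul_le_mul_of_nonneg_right _ (by positivity)
      rw [sub_sq]
      linarith
    have b2 : (q : ℤ) ^ 2 * (X + q ^ 4) ≤ (q ^ 2 + 1) * X := by
      have : (q : ℤ) ^ 2 * q ^ 4 = ((q : ℤ) ^ 2) ^ 3 := by ring
      linarith
    have b3 : ((q : ℤ) ^ 2 + 1) * X ≤ q ^ 4 * X := by
      apply mul_le_mul_of_nonneg_right _ hX0.le
      nlinarith
    linarith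
  · intro r
    exact orbit2 hq3' hPn.symm hP0 r
  · intro r hr0 hr
    exact orbit3 (j + 1) hq3' hPn.symm hP hR r hr0 (by omega)
  · intro r hr0 hr
    exact orbit4 j hq3' hPn.symm hP hS r hr0 (by omega)
  · intro u v c hB h0 hu hu4
    rw [hRS] at hu4 ⊢
    have hle := mul_le_mul_of_nonneg_left hu4 hQ.le
    have := hB.main10 (j + 2) (by omega) hn' (by
      rw [hl1, ← hX]
      linear_combination hle + q * hPn + ((q : ℤ) - 1) ^ 2 * hR) h0 hu
    rw [hl1, ← hX] at this
    rcases this with h | h | h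
    · left
      apply mul_left_cancel₀ hQ.ne'
      linear_combination h - q * hPn
    · right; left
      apply mul_left_cancel₀ hQ.ne'
      linear_combination h - q * hPn - ((q : ℤ) - 1) ^ 2 * hR
    · right; right
      apply mul_left_cancel₀ hQ.ne'
      linear_combination h - q * hPn - ((q : ℤ) - 1) ^ 2 * hR
  · intro hlt _
    exact d3 hlt
  · intro hlt hlt4
    have := d3 hlt
    have hc : (((q - 1) ^ 2 * (q ^ 2 - 1) : ℕ) : ℤ) = ((q : ℤ) - 1) ^ 2 * (q ^ 2 - 1) := by
      push_cast [Nat.cast_sub (show 1 ≤ q by omega), Nat.cast_sub (show 1 ≤ q ^ 2 by nlinarith)]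
      ring
    rw [hRS] at hlt4 ⊢
    rw [h4, Nat.cast_sub (by rw [← Int.ofNat_le]; rw [hc, this]; linarith), hc, this]
    ring

/-- for odd prime power `q`, `m ≡ 2 (mod 4)`, `m ≥ 6`, `n = q^m+1`,
the third and fourth largest coset leaders are `δ_3` and `δ_4`, each with coset size `2m`. -/
theorem stmt_5 (q m n : ℕ) (hq : IsPrimePow q) (hodd : Odd q)
    (hm4 : m % 4 = 2) (hm : 6 ≤ m) (hn : n = q ^ m + 1)
    (δ3 δ4 : ℕ)
    (h3 : δ3 = (q - 1) ^ 2 * (q ^ m - 2 * q ^ (m - 4) - 1) / (2 * (q ^ 2 + 1)))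
    (h4 : (m = 6 → δ4 = δ3 - q * (q - 1) ^ 2) ∧
          (6 < m → δ4 = δ3 - (q - 1) ^ 2 * (q ^ 2 - 1))) :
    nthLargestCosetLeader q n 3 = δ3 ∧ nthLargestCosetLeader q n 4 = δ4 ∧
    (cycCoset q n δ3).card = 2 * m ∧ (cycCoset q n δ4).card = 2 * m := by
  have hq3 : 3 ≤ q := by
    have := hq.one_lt
    obtain ⟨t, rfl⟩ := hodd
    omega
  rcases hm.eq_or_lt with rfl | hlt
  · exact case_six hodd hq3 hn h3 (h4.1 rfl)
  · obtain ⟨j, rfl⟩ : ∃ j, m = 2 * (2 * (j + 2) + 1) := ⟨(m - 10) / 4, by omega⟩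
    exact case_big hodd hq3 hn h3 (h4.2 hlt)
end

section
/- Let q be an odd prime power, λ an integer with 2 ≤ λ < q+1 and λ ∣ (q+1), m = 2t+1 ≥ 5, and n = (q^m+1)/λ. Define sets of integers as follows. If t is even: T_1 = { (q^{t+1}+1)/λ + c : c ∈ ℤ, -q/λ ≤ c ≤ (q-2)/λ }, T_2 = { (q^{t+1}+1)/λ + b·q^t : b ∈ ℤ, 1 ≤ b ≤ (q-1)/λ }, T_3 = { (q^{t+1}+1)/λ + 2(q^t-1)/λ + b·q^t : b ∈ ℤ, 0 ≤ b ≤ (q-3)/λ }. If t is odd: T_1 = { (q^{t+1}-1)/λ + c : c ∈ ℤ, -(q-2)/λ ≤ c ≤ q/λ }, T_2 = { (q^{t+1}-1)/λ + b·q^t : b ∈ ℤ, 1 ≤ b ≤ (q-1)/λ }, T_3 = { (q^{t+1}-1)/λ + 2(q^t+1)/λ + b·q^t : b ∈ ℤ, 0 ≤ b ≤ (q-3)/λ }. Then: (1) every integer i with 1 ≤ i < (2q^{t+1}-2q+1)/λ and q ∤ i is a coset leader modulo n with q-cyclotomic coset of exactly 2m elements, except when i ∈ T_1 ∪ T_2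 ∪ T_3; (2) no integer i with (2q^{t+1}-2q+1)/λ ≤ i ≤ (2q^{t+1}+2q-1)/λ is a coset leader modulo n. -/
theorem dvdc8 {a b c : ℤ} (h : a ∣ b) (e : c = b) : a ∣ c := e ▸ h

theorem core8 (q : ℤ) (t j : ℕ) (hq : 3 ≤ q) (ht : 2 ≤ t) (a y : ℤ) (ha : 0 < a)
    (haM : a ≤ 2 * q ^ (t + 1) - 2 * q) (hy1 : y ≤ 2 * q ^ (t + 1) - 2 * q)
    (hy2 : -y ≤ 2 * q ^ (t + 1) - 2 * q) (hj : j ≤ t)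
    (hd : q ^ (2 * t + 1) + 1 ∣ a * q ^ j - y) (hne : a * q ^ j ≠ y) :
    ∃ s : ℤ, a = q ^ (t + 1) + s ∧ y = s * q ^ t - 1 ∧ s ≤ 2 * q - 1 ∧ -(2 * q - 1) ≤ s := by
  obtain ⟨k, hk⟩ := hd
  have hP : q ^ 2 ≤ q ^ t := pow_le_pow_right₀ (by linarith) ht
  have hjt : q ^ j ≤ q ^ t := pow_le_pow_right₀ (by linarith) hj
  have hj0 : 0 < q ^ j := by positivity
  have e1 : q ^ (t + 1) = q * q ^ t := by ring
  have e2 : q ^ (2 * t + 1) = q * q ^ t * q ^ t := by ring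
  rw [e1] at haM hy1 hy2 ⊢
  rw [e2] at hk
  have hj' : j = t ∨ q * q ^ j ≤ q ^ t := by
    rcases hj.eq_or_lt with h | h
    · exact Or.inl h
    · right
      have : q ^ (j + 1) ≤ q ^ t := pow_le_pow_right₀ (by linarith) h
      calc q * q ^ j = q ^ (j + 1) := by ring
        _ ≤ _ := this
  have ht9 : 3 * q ≤ q ^ t := by nlinarith
  generalize hPP : q ^ t = P at *
  have hqP : 3 * P ≤ q * P := by nlinarith
  have hqPP : 3 * (q * P) ≤ q * P * P := by nlinarith
  have haj : a * q ^ j ≤ (2 * (q * P) - 2 * q) * P := by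
    apply mul_le_mul haM hjt hj0.le; linarith
  have hk1 : k = 1 := by
    have h0 : 0 < a * q ^ j := by positivity
    have hNpos : 0 < q * P * P + 1 := by nlinarith
    have hkl : -1 < k := by
      by_contra h
      have : k ≤ -1 := by linarith
      nlinarith
    have hku : k < 2 := by
      by_contra h
      have : 2 ≤ k := by linarith
      nlinarith
    have hk0 : k ≠ 0 := by
      rintro rfl
      apply hne; linarith
    omega
  subst hk1
  rcases hj' with rfl | hj'
  · rw [hPP] at hk
    refine ⟨a - q * P, by ring, by linarith, ?_, ?_⟩
    · by_contra h
      have : 2 * q ≤ a - q * P := by linarith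
      nlinarith
    · by_contra h
      have : a - q * P ≤ -(2 * q) := by linarith
      nlinarith
  · exfalso
    have h1 : a * q ^ j ≤ (2 * (q * P)) * q ^ j := by
      apply mul_le_mul_of_nonneg_right _ hj0.le; linarith
    have h2 : (2 * (q * P)) * q ^ j ≤ 2 * P * P := by nlinarith
    have h3 : 3 * P * P ≤ q * P * P := by nlinarith
    have h4 : 3 * q * P ≤ P * P := by nlinarith
    nlinarith

theorem class8 (q : ℤ) (t d : ℕ) (hq : 3 ≤ q) (ht : 2 ≤ t) (x y : ℤ) (hx : 0 < x)
    (hxM : x ≤ 2 * q ^ (t + 1) - 2 * q) (hqx : ¬ q ∣ x) (hd0 : 0 < d) (hdm : d < 2 * t + 1)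
    (hy1 : y ≤ x) (hy2 : -y ≤ x) (hd : q ^ (2 * t + 1) + 1 ∣ x * q ^ d - y) :
    ∃ s : ℤ, (x = q ^ (t + 1) + s ∧ s ≤ q - 1 ∧ -(q - 1) ≤ s) ∨
      (x = s * q ^ t - 1 ∧ q + 1 ≤ s ∧ s ≤ 2 * q - 1) ∨
      (x = s * q ^ t + 1 ∧ q ≤ s ∧ s ≤ 2 * q - 1) := by
  have hP : q ^ 2 ≤ q ^ t := pow_le_pow_right₀ (by linarith) ht
  have e1 : q ^ (t + 1) = q * q ^ t := by ring
  have ht9 : 3 * q ≤ q ^ t := by nlinarith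
  by_cases hdt : d ≤ t
  · obtain ⟨s, h1, h2, h3, h4⟩ := core8 q t d hq ht x y hx hxM (by linarith) (by linarith) hdt hd (by
      intro h
      have : q ^ 1 ≤ q ^ d := pow_le_pow_right₀ (by linarith) hd0
      nlinarith)
    refine ⟨s, Or.inl ⟨h1, ?_, ?_⟩⟩
    · have hs : s ≠ q := by
        rintro rfl
        exact hqx ⟨s ^ t + 1, by rw [h1]; ring⟩
      by_contra h
      have : q + 1 ≤ s := by omega
      rw [e1] at h1
      generalize q ^ t = P at *
      nlinarith
    · by_contra h
      have : s ≤ -q := by omega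
      rw [e1] at h1
      generalize q ^ t = P at *
      nlinarith
  · have hmd : 2 * t + 1 - d ≤ t := by omega
    have hmd0 : 2 * t + 1 - d ≠ 0 := by omega
    have hpw : q ^ d * q ^ (2 * t + 1 - d) = q ^ (2 * t + 1) := by
      rw [← pow_add]; congr 1; omega
    have hD : q ^ (2 * t + 1) + 1 ∣ y * q ^ (2 * t + 1 - d) + x := by
      obtain ⟨k, hk⟩ := hd
      refine ⟨x - k * q ^ (2 * t + 1 - d), ?_⟩
      have : y = x * q ^ d - (q ^ (2 * t + 1) + 1) * k := by linarith
      rw [this]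
      linear_combination x * hpw
    have hqd : q ∣ q ^ (2 * t + 1 - d) := dvd_pow_self q hmd0
    have hy0 : y ≠ 0 := by
      rintro rfl
      rw [zero_mul, zero_add] at hD
      have := Int.le_of_dvd hx hD
      have e2 : q ^ (2 * t + 1) = q * q ^ t * q ^ t := by ring
      rw [e1] at hxM
      rw [e2] at this
      generalize q ^ t = P at *
      have : 3 * (q * P) ≤ q * P * P := by nlinarith
      nlinarith
    rcases lt_or_gt_of_ne hy0 with hneg | hpos
    · obtain ⟨s, h1, h2, h3, h4⟩ := core8 q t _ hq ht (-y) x (by linarith) (by linarith) hxM (by linarith)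
        hmd (by rw [← Int.dvd_neg]; convert hD using 1; ring) (by
          intro h; exact hqx (h ▸ Dvd.dvd.mul_left hqd _))
      refine ⟨s, Or.inr (Or.inl ⟨h2, ?_, h3⟩)⟩
      by_contra h
      have : s ≤ q := by omega
      rw [e1] at h1
      generalize q ^ t = P at *
      rcases this.eq_or_lt with h | h
      · subst h; nlinarith
      · have : s ≤ q - 1 := by omega
        nlinarith
    · obtain ⟨s, h1, h2, h3, h4⟩ := core8 q t _ hq ht y (-x) (by linarith) (by linarith) (by linarith)
        (by linarith) hmd (by convert hD using 1; ring) (by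
          intro h; exact hqx (by rw [← Int.dvd_neg, ← h]; exact Dvd.dvd.mul_left hqd _))
      refine ⟨-s, Or.inr (Or.inr ⟨by linarith, ?_, by linarith⟩)⟩
      by_contra h
      have : -s ≤ q - 1 := by omega
      rw [e1] at h1
      generalize q ^ t = P at *
      have h7 : 1 * P ≤ (q + s) * P := mul_le_mul_of_nonneg_right (by linarith) (by linarith)
      linarith

theorem ordpos8 (q n m : ℕ) (hm : 0 < m) (h : n ∣ q ^ m + 1) :
    (q : ZMod n) ^ (2 * m) = 1 ∧ 0 < orderOf (q : ZMod n) ∧ orderOf (q : ZMod n) ≤ 2 * m := by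
  have h1 : ((q ^ m + 1 : ℕ) : ZMod n) = 0 := (ZMod.natCast_eq_zero_iff _ _).2 h
  push_cast at h1
  have h2 : (q : ZMod n) ^ (2 * m) = 1 := by
    have : (q : ZMod n) ^ m = -1 := eq_neg_of_add_eq_zero_left h1
    rw [mul_comm, pow_mul, this]; ring
  exact ⟨h2, orderOf_pos_iff.2 (isOfFinOrder_iff_pow_eq_one.2 ⟨2 * m, by omega, h2⟩),
    orderOf_le_of_pow_eq_one (by omega) h2⟩

theorem mem8 (q n m i j : ℕ) (hm : 0 < m) (h : n ∣ q ^ m + 1) :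
    i * q ^ j % n ∈ cycCoset q n i := by
  obtain ⟨-, h2, -⟩ := ordpos8 q n m hm h
  refine Finset.mem_image.2 ⟨j % orderOf (q : ZMod n), Finset.mem_range.2 (Nat.mod_lt _ h2), ?_⟩
  apply (ZMod.natCast_eq_natCast_iff' _ _ _).1
  push_cast
  rw [pow_mod_orderOf]

theorem coset8 (q n m i : ℕ) (hm : 0 < m) (h : n ∣ q ^ m + 1) :
    cycCoset q n i = (Finset.range (2 * m)).image fun j => i * q ^ j % n := by
  obtain ⟨-, h2, h3⟩ := ordpos8 q n m hm h
  apply Finset.Subset.antisymm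
  · exact Finset.image_subset_image (Finset.range_mono h3)
  · intro z hz
    obtain ⟨j, -, rfl⟩ := Finset.mem_image.1 hz
    exact mem8 q n m i j hm h

theorem lead8 (q n lam m i : ℕ) (hm : 0 < m) (hlam : 0 < lam) (hi : 0 < i)
    (hN : lam * n = q ^ m + 1) (hsm : 2 * (lam * i) < q ^ m + 1)
    (key : ∀ d : ℕ, 0 < d → d < m → ∀ y : ℤ, y ≤ lam * i → -y ≤ lam * i →
      ¬ (q : ℤ) ^ m + 1 ∣ (lam * i) * q ^ d - y) :
    IsCosetLeader q n i ∧ (cycCoset q n i).card = 2 * m := by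
  have hdv : n ∣ q ^ m + 1 := ⟨lam, by rw [← hN]; ring⟩
  have hin : i < n := by
    by_contra h
    have : lam * n ≤ lam * i := Nat.mul_le_mul_left _ (by omega)
    omega
  have hNz : (lam : ℤ) * n = (q : ℤ) ^ m + 1 := by exact_mod_cast hN
  have hsz : 2 * ((lam : ℤ) * i) < (q : ℤ) ^ m + 1 := by exact_mod_cast hsm
  have hlz : (0 : ℤ) < lam := by exact_mod_cast hlam
  have hiz : (0 : ℤ) < i := by exact_mod_cast hi
  have hxz : (0 : ℤ) < lam * i := by positivity
  -- extended key for exponents below `2 m`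
  have key2 : ∀ d : ℕ, 0 < d → d < 2 * m → ∀ y : ℤ, 0 ≤ y → y ≤ lam * i →
      ¬ (q : ℤ) ^ m + 1 ∣ (lam * i) * q ^ d - y := by
    intro d hd0 hd2 y hy0 hy1 hdd
    rcases lt_trichotomy d m with h | h | h
    · exact key d hd0 h y hy1 (by linarith) hdd
    · subst h
      have h1 : (q : ℤ) ^ d + 1 ∣ (lam : ℤ) * i + y := by
        have := Int.dvd_sub (Dvd.intro_left ((lam : ℤ) * i) rfl) hdd
        exact dvdc8 this (by ring)
      have := Int.le_of_dvd (by linarith) h1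
      linarith
    · refine key (d - m) (by omega) (by omega) (-y) (by linarith) (by linarith) ?_
      have hp : (q : ℤ) ^ d = q ^ m * q ^ (d - m) := by
        rw [← pow_add]; congr 1; omega
      have := Int.dvd_sub (Dvd.intro_left ((lam : ℤ) * i * q ^ (d - m)) rfl) hdd
      convert this using 1
      rw [hp]; ring
  -- lifting residues mod `n` to residues mod `q ^ m + 1`
  have lift : ∀ (d r : ℕ), i * q ^ d ≡ r [MOD n] →
      (q : ℤ) ^ m + 1 ∣ (lam * i) * q ^ d - lam * r := by
    intro d r h
    have h1 : (n : ℤ) ∣ ((i * q ^ d : ℕ) : ℤ) - r := Nat.modEq_iff_dvd.1 h.symm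
    have h2 := mul_dvd_mul_left (lam : ℤ) h1
    rw [hNz] at h2
    exact dvdc8 h2 (by push_cast; ring)
  have hcop : Nat.Coprime n q := by
    have : Nat.Coprime (q ^ m + 1) q := by
      obtain ⟨m', rfl⟩ : ∃ m', m = m' + 1 := ⟨m - 1, by omega⟩
      rw [pow_succ]
      simp
    exact Nat.Coprime.coprime_dvd_left hdv this
  rw [IsCosetLeader, coset8 q n m i hm hdv]
  refine ⟨⟨Finset.mem_image.2 ⟨0, Finset.mem_range.2 (by omega), by simp [Nat.mod_eq_of_lt hin]⟩, ?_⟩, ?_⟩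
  · intro z hz
    obtain ⟨j, hj, rfl⟩ := Finset.mem_image.1 hz
    rw [Finset.mem_range] at hj
    by_contra hlt
    push Not at hlt
    rcases Nat.eq_zero_or_pos j with rfl | hj0
    · simp [Nat.mod_eq_of_lt hin] at hlt
    · refine key2 j hj0 hj (lam * ((i * q ^ j % n : ℕ) : ℤ)) (by positivity) ?_
        (lift j _ (Nat.mod_modEq _ _).symm)
      exact_mod_cast Nat.mul_le_mul_left lam hlt.le
  · rw [Finset.card_image_of_injOn, Finset.card_range]
    have aux : ∀ a b : ℕ, a < b → b < 2 * m → i * q ^ a % n ≠ i * q ^ b % n := by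
      intro a b hab hb h
      have h1 : i * q ^ (b - a) ≡ i [MOD n] := by
        apply Nat.ModEq.cancel_right_of_coprime (c := q ^ a) (Nat.Coprime.pow_right _ hcop)
        have : i * q ^ (b - a) * q ^ a = i * q ^ b := by
          rw [mul_assoc, ← pow_add]; congr 2; omega
        rw [this]
        exact h.symm
      exact key2 (b - a) (by omega) (by omega) (lam * i) (by positivity) le_rfl (lift _ _ h1)
    intro a ha b hb h
    simp only [Finset.coe_range, Set.mem_Iio] at ha hb
    rcases lt_trichotomy a b with h' | h' | h'
    · exact absurd h (aux a b h' hb)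
    · exact h'
    · exact absurd h.symm (aux b a h' ha)

theorem notlead8 (q n lam m i j : ℕ) (hm : 0 < m) (hlam : 0 < lam)
    (hN : lam * n = q ^ m + 1) (y : ℤ) (hy1 : y < lam * i) (hy2 : -y < lam * i)
    (hd : (q : ℤ) ^ m + 1 ∣ (lam * i) * q ^ j - y) : ¬ IsCosetLeader q n i := by
  have hdv : n ∣ q ^ m + 1 := ⟨lam, by rw [← hN]; ring⟩
  have hNz : (lam : ℤ) * n = (q : ℤ) ^ m + 1 := by exact_mod_cast hN
  have hlz : (0 : ℤ) < lam := by exact_mod_cast hlam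
  have main : ∀ (j : ℕ) (y : ℤ), 0 ≤ y → y < lam * i →
      (q : ℤ) ^ m + 1 ∣ (lam * i) * q ^ j - y → ¬ IsCosetLeader q n i := by
    intro j y h0 h1 h2 hL
    have h3 := hL.2 _ (mem8 q n m i j hm hdv)
    have hly : (lam : ℤ) ∣ y := by
      have h4 : (lam : ℤ) ∣ (lam * i) * q ^ j - y := (Dvd.intro _ hNz).trans h2
      exact (Int.dvd_iff_dvd_of_dvd_sub h4).1 ⟨i * q ^ j, by ring⟩
    obtain ⟨r, rfl⟩ := hly
    have hr0 : 0 ≤ r := nonneg_of_mul_nonneg_right h0 hlz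
    have hri : r < i := lt_of_mul_lt_mul_left h1 hlz.le
    obtain ⟨r, rfl⟩ := Int.eq_ofNat_of_zero_le hr0
    have hri' : r < i := by exact_mod_cast hri
    have h5 : (n : ℤ) ∣ ((i * q ^ j : ℕ) : ℤ) - r := by
      apply Int.dvd_of_mul_dvd_mul_left hlz.ne'
      rw [hNz]
      exact dvdc8 h2 (by push_cast; ring)
    have h6 : r ≡ i * q ^ j [MOD n] := Nat.modEq_iff_dvd.2 h5
    have h7 : i * q ^ j % n ≤ r := by
      rw [← h6]; exact Nat.mod_le _ _
    omega
  rcases le_or_gt 0 y with h | h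
  · exact main j y h hy1 hd
  · refine main (j + m) (-y) (by linarith) hy2 ?_
    have := Int.dvd_sub (Dvd.intro_left ((lam : ℤ) * i * q ^ j) rfl) hd
    rw [← Int.dvd_neg]
    have h2 := Int.dvd_sub this (Dvd.intro_left (2 * ((lam : ℤ) * i * q ^ j)) rfl)
    rw [← Int.dvd_neg] at this
    have h3 := Int.dvd_sub hd (Dvd.intro_left ((lam : ℤ) * i * q ^ j) rfl)
    convert h3 using 1
    rw [pow_add]; ring

set_option maxHeartbeats 2000000 in
/-- coset leaders modulo `n = (q^m+1)/λ` for `m = 2t+1 ≥ 5`,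
`2 ≤ λ < q+1`, `λ ∣ q+1`, `q` an odd prime power. -/
theorem stmt_8 (q lam t m n : ℕ) (hq : IsPrimePow q) (hodd : Odd q)
    (hlam : 2 ≤ lam) (hlt : lam < q + 1) (hdvd : lam ∣ q + 1)
    (hm : m = 2 * t + 1) (hm5 : 5 ≤ m) (hn : n = (q ^ m + 1) / lam)
    (T1 T2 T3 : Set ℕ)
    (hT1even : Even t → T1 = {i : ℕ | ∃ c : ℤ,
        -(q : ℚ) / (lam : ℚ) ≤ (c : ℚ) ∧ (c : ℚ) ≤ ((q : ℚ) - 2) / (lam : ℚ) ∧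
        (i : ℤ) = (((q ^ (t + 1) + 1) / lam : ℕ) : ℤ) + c})
    (hT2even : Even t → T2 = {i : ℕ | ∃ b : ℕ, 1 ≤ b ∧ (b : ℚ) ≤ ((q : ℚ) - 1) / (lam : ℚ) ∧
        i = (q ^ (t + 1) + 1) / lam + b * q ^ t})
    (hT3even : Even t → T3 = {i : ℕ | ∃ b : ℕ, (b : ℚ) ≤ ((q : ℚ) - 3) / (lam : ℚ) ∧
        i = (q ^ (t + 1) + 1) / lam + 2 * (q ^ t - 1) / lam + b * q ^ t})
    (hT1odd : Odd t → T1 = {i : ℕ | ∃ c : ℤ,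
        -((q : ℚ) - 2) / (lam : ℚ) ≤ (c : ℚ) ∧ (c : ℚ) ≤ (q : ℚ) / (lam : ℚ) ∧
        (i : ℤ) = (((q ^ (t + 1) - 1) / lam : ℕ) : ℤ) + c})
    (hT2odd : Odd t → T2 = {i : ℕ | ∃ b : ℕ, 1 ≤ b ∧ (b : ℚ) ≤ ((q : ℚ) - 1) / (lam : ℚ) ∧
        i = (q ^ (t + 1) - 1) / lam + b * q ^ t})
    (hT3odd : Odd t → T3 = {i : ℕ | ∃ b : ℕ, (b : ℚ) ≤ ((q : ℚ) - 3) / (lam : ℚ) ∧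
        i = (q ^ (t + 1) - 1) / lam + 2 * (q ^ t + 1) / lam + b * q ^ t}) :
    (∀ i : ℕ, 1 ≤ i → (i : ℚ) < (2 * (q : ℚ) ^ (t + 1) - 2 * q + 1) / (lam : ℚ) → ¬ q ∣ i →
      i ∉ T1 ∪ T2 ∪ T3 → IsCosetLeader q n i ∧ (cycCoset q n i).card = 2 * m) ∧
    (∀ i : ℕ, (2 * (q : ℚ) ^ (t + 1) - 2 * q + 1) / (lam : ℚ) ≤ (i : ℚ) →
      (i : ℚ) ≤ (2 * (q : ℚ) ^ (t + 1) + 2 * q - 1) / (lam : ℚ) → ¬ IsCosetLeader q n i) := by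
  have hq3 : 3 ≤ q := by
    have := hq.one_lt
    obtain ⟨k, rfl⟩ := hodd
    omega
  have ht : 2 ≤ t := by omega
  subst hm
  have hQ3 : (3 : ℤ) ≤ q := by exact_mod_cast hq3
  have hlz : (0 : ℤ) < lam := by exact_mod_cast (by omega : 0 < lam)
  have hlQ : (0 : ℚ) < lam := by exact_mod_cast (by omega : 0 < lam)
  have hdz : (lam : ℤ) ∣ q + 1 := by exact_mod_cast hdvd
  have hqt : ∀ k : ℕ, (lam : ℤ) ∣ (q : ℤ) ^ k - (-1) ^ k := by
    intro k
    refine Dvd.dvd.trans ?_ (sub_dvd_pow_sub_pow (q : ℤ) (-1) k)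
    simpa using hdz
  have hN : lam * n = q ^ (2 * t + 1) + 1 := by
    rw [hn]
    apply Nat.mul_div_cancel'
    have := hqt (2 * t + 1)
    rw [pow_succ (-1 : ℤ), pow_mul] at this
    have h2 : (lam : ℤ) ∣ ((q ^ (2 * t + 1) + 1 : ℕ) : ℤ) := by
      push_cast; simpa using this
    exact_mod_cast h2
  have hP : (q : ℤ) ^ 2 ≤ (q : ℤ) ^ t := pow_le_pow_right₀ (by linarith) ht
  have e1 : (q : ℤ) ^ (t + 1) = q * q ^ t := by ring
  have e2 : (q : ℤ) ^ (2 * t + 1) = q * q ^ t * q ^ t := by ring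
  have ht9 : 3 * (q : ℤ) ≤ q ^ t := by nlinarith
  constructor
  · intro i hi1 hiB hqi hiT
    have hiB' : (lam : ℤ) * i ≤ 2 * (q : ℤ) ^ (t + 1) - 2 * q := by
      rw [lt_div_iff₀ hlQ] at hiB
      have : (i : ℤ) * lam < 2 * (q : ℤ) ^ (t + 1) - 2 * q + 1 := by exact_mod_cast hiB
      linarith
    have hxpos : (0 : ℤ) < lam * i := by
      have : (0 : ℤ) < i := by exact_mod_cast hi1
      positivity
    have hqx : ¬ (q : ℤ) ∣ lam * i := by
      intro h
      apply hqi
      have h' : q ∣ lam * i := by exact_mod_cast h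
      have hc : Nat.Coprime q lam := by
        have : Nat.Coprime q (q + 1) := by simp
        exact Nat.Coprime.coprime_dvd_right hdvd this
      exact hc.dvd_of_dvd_mul_left h'
    apply lead8 q n lam (2 * t + 1) i (by omega) (by omega) hi1 hN
    · have : 2 * ((lam : ℤ) * i) < (q : ℤ) ^ (2 * t + 1) + 1 := by
        rw [e1] at hiB'
        rw [e2]
        have h3 : (q : ℤ) * q ^ t * 9 ≤ q * q ^ t * q ^ t := by
          apply mul_le_mul_of_nonneg_left (by linarith); positivity
        have : (0 : ℤ) < q * q ^ t := by positivity
        linarith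
      exact_mod_cast this
    · intro d hd0 hdm y hy1 hy2 hdd
      apply hiT
      obtain ⟨s, hs⟩ := class8 q t d hQ3 ht _ y hxpos hiB' hqx hd0 hdm hy1 hy2 hdd
      have hPt := hqt t
      generalize hx : (lam : ℤ) * i = x at *
      have hlx : (lam : ℤ) ∣ x := ⟨i, hx.symm⟩
      rcases Nat.even_or_odd t with hev | hod
      · rw [hT1even hev, hT2even hev, hT3even hev]
        rw [hev.neg_one_pow] at hPt
        have hA : (lam : ℤ) * (((q ^ (t + 1) + 1) / lam : ℕ) : ℤ) = q * q ^ t + 1 := by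
          have h := hqt (t + 1)
          rw [hev.add_one.neg_one_pow] at h
          have h2 : lam ∣ q ^ (t + 1) + 1 := by
            have : (lam : ℤ) ∣ ((q ^ (t + 1) + 1 : ℕ) : ℤ) := by push_cast; simpa using h
            exact_mod_cast this
          have := Nat.mul_div_cancel' h2
          rw [← e1]; exact_mod_cast this
        have hB : (lam : ℤ) * ((2 * (q ^ t - 1) / lam : ℕ) : ℤ) = 2 * (q ^ t - 1) := by
          have h1 : 1 ≤ q ^ t := Nat.one_le_pow _ _ (by omega)
          have hc : ((2 * (q ^ t - 1) : ℕ) : ℤ) = 2 * ((q : ℤ) ^ t - 1) := by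
            push_cast [Nat.cast_sub h1]; ring
          have h2 : lam ∣ 2 * (q ^ t - 1) := by
            have : (lam : ℤ) ∣ ((2 * (q ^ t - 1) : ℕ) : ℤ) := by
              rw [hc]; exact Dvd.dvd.mul_left hPt _
            exact_mod_cast this
          rw [← hc]
          exact_mod_cast Nat.mul_div_cancel' h2
        generalize hAg : (q ^ (t + 1) + 1) / lam = A at *
        generalize hBg : 2 * (q ^ t - 1) / lam = B at *
        have mT1 : ∀ c : ℤ, -(q : ℤ) ≤ lam * c → lam * c ≤ q - 2 → x = q * q ^ t + 1 + lam * c →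
            i ∈ ({i : ℕ | ∃ c : ℤ, -(q : ℚ) / (lam : ℚ) ≤ (c : ℚ) ∧
              (c : ℚ) ≤ ((q : ℚ) - 2) / (lam : ℚ) ∧ (i : ℤ) = (A : ℤ) + c} : Set ℕ) := by
          intro c h1 h2 h3
          refine ⟨c, ?_, ?_, ?_⟩
          · rw [div_le_iff₀ hlQ, mul_comm]; exact_mod_cast h1
          · rw [le_div_iff₀ hlQ, mul_comm]; exact_mod_cast h2
          · apply mul_left_cancel₀ hlz.ne'
            rw [hx, mul_add, hA, h3]
        rcases hs with ⟨h1, h2, h3⟩ | ⟨h1, h2, h3⟩ | ⟨h1, h2, h3⟩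
        · left; left
          have : (lam : ℤ) ∣ s - 1 := by
            have := dvd_sub hlx (Dvd.intro _ hA)
            rw [h1, e1] at this
            exact dvdc8 this (by ring)
          obtain ⟨c, hc⟩ := this
          exact mT1 c (by linarith) (by linarith) (by rw [h1, e1]; linarith)
        · right
          have : (lam : ℤ) ∣ s - (q + 2) := by
            have h := dvd_sub (dvd_sub hlx (Dvd.dvd.mul_left hPt s)) hdz
            rw [h1] at h
            exact dvdc8 h (by ring)
          obtain ⟨c, hc⟩ := this
          have hc0 : 0 ≤ c := by
            by_contra h
            have : c ≤ -1 := by omega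
            have : (2 : ℤ) ≤ lam := by exact_mod_cast hlam
            nlinarith
          obtain ⟨b, rfl⟩ := Int.eq_ofNat_of_zero_le hc0
          refine ⟨b, ?_, ?_⟩
          · rw [le_div_iff₀ hlQ, mul_comm]
            have : (lam : ℤ) * b ≤ q - 3 := by linarith
            exact_mod_cast this
          · have : (i : ℤ) = A + B + b * q ^ t := by
              apply mul_left_cancel₀ hlz.ne'
              rw [hx, h1]
              linear_combination (q : ℤ) ^ t * hc - hA - hB
            exact_mod_cast this
        · have : (lam : ℤ) ∣ s - q := by
            have h := dvd_sub (dvd_sub hlx (Dvd.dvd.mul_left hPt s)) hdz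
            rw [h1] at h
            exact dvdc8 h (by ring)
          obtain ⟨c, hc⟩ := this
          have hc0 : 0 ≤ c := by
            by_contra h
            nlinarith
          obtain ⟨b, rfl⟩ := Int.eq_ofNat_of_zero_le hc0
          left
          rcases Nat.eq_zero_or_pos b with rfl | hb
          · left
            refine mT1 0 (by simp) (by linarith) ?_
            have : s = q := by simp at hc; linarith
            rw [h1, this]; ring
          · right
            refine ⟨b, hb, ?_, ?_⟩
            · rw [le_div_iff₀ hlQ, mul_comm]
              have : (lam : ℤ) * b ≤ q - 1 := by linarith
              exact_mod_cast this
            · have : (i : ℤ) = A + b * q ^ t := by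
                apply mul_left_cancel₀ hlz.ne'
                rw [hx, h1]
                linear_combination (q : ℤ) ^ t * hc - hA
              exact_mod_cast this
      · rw [hT1odd hod, hT2odd hod, hT3odd hod]
        rw [hod.neg_one_pow] at hPt
        have hA : (lam : ℤ) * (((q ^ (t + 1) - 1) / lam : ℕ) : ℤ) = q * q ^ t - 1 := by
          have h := hqt (t + 1)
          rw [hod.add_one.neg_one_pow] at h
          have h1 : 1 ≤ q ^ (t + 1) := Nat.one_le_pow _ _ (by omega)
          have hc : ((q ^ (t + 1) - 1 : ℕ) : ℤ) = (q : ℤ) ^ (t + 1) - 1 := by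
            push_cast [Nat.cast_sub h1]; ring
          have h2 : lam ∣ q ^ (t + 1) - 1 := by
            rw [← hc] at h
            exact_mod_cast h
          rw [← e1, ← hc]
          exact_mod_cast Nat.mul_div_cancel' h2
        have hB : (lam : ℤ) * ((2 * (q ^ t + 1) / lam : ℕ) : ℤ) = 2 * (q ^ t + 1) := by
          have h2 : lam ∣ 2 * (q ^ t + 1) := by
            have : (lam : ℤ) ∣ ((2 * (q ^ t + 1) : ℕ) : ℤ) := by
              push_cast; apply Dvd.dvd.mul_left; simpa using hPt
            exact_mod_cast this
          exact_mod_cast Nat.mul_div_cancel' h2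
        generalize hAg : (q ^ (t + 1) - 1) / lam = A at *
        generalize hBg : 2 * (q ^ t + 1) / lam = B at *
        have mT1 : ∀ c : ℤ, -((q : ℤ) - 2) ≤ lam * c → lam * c ≤ q → x = q * q ^ t - 1 + lam * c →
            i ∈ ({i : ℕ | ∃ c : ℤ, -((q : ℚ) - 2) / (lam : ℚ) ≤ (c : ℚ) ∧
              (c : ℚ) ≤ (q : ℚ) / (lam : ℚ) ∧ (i : ℤ) = (A : ℤ) + c} : Set ℕ) := by
          intro c h1 h2 h3
          refine ⟨c, ?_, ?_, ?_⟩
          · rw [div_le_iff₀ hlQ, mul_comm]; exact_mod_cast h1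
          · rw [le_div_iff₀ hlQ, mul_comm]; exact_mod_cast h2
          · apply mul_left_cancel₀ hlz.ne'
            rw [hx, mul_add, hA, h3]
        rcases hs with ⟨h1, h2, h3⟩ | ⟨h1, h2, h3⟩ | ⟨h1, h2, h3⟩
        · left; left
          have : (lam : ℤ) ∣ s + 1 := by
            have := dvd_sub hlx (Dvd.intro _ hA)
            rw [h1, e1] at this
            exact dvdc8 this (by ring)
          obtain ⟨c, hc⟩ := this
          exact mT1 c (by linarith) (by linarith) (by rw [h1, e1]; linarith)
        · left; right
          have : (lam : ℤ) ∣ s - q := by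
            have h := dvd_add (dvd_sub hlx (Dvd.dvd.mul_left hPt s)) hdz
            rw [h1] at h
            rw [← dvd_neg]
            exact dvdc8 h (by ring)
          obtain ⟨c, hc⟩ := this
          have hc0 : 0 ≤ c := by
            by_contra h
            nlinarith
          obtain ⟨b, rfl⟩ := Int.eq_ofNat_of_zero_le hc0
          refine ⟨b, ?_, ?_, ?_⟩
          · rcases Nat.eq_zero_or_pos b with rfl | hb
            · simp at hc; omega
            · exact hb
          · rw [le_div_iff₀ hlQ, mul_comm]
            have : (lam : ℤ) * b ≤ q - 1 := by linarith
            exact_mod_cast this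
          · have : (i : ℤ) = A + b * q ^ t := by
              apply mul_left_cancel₀ hlz.ne'
              rw [hx, h1]
              linear_combination (q : ℤ) ^ t * hc - hA
            exact_mod_cast this
        · have : (lam : ℤ) ∣ s - (q + 2) := by
            have h := dvd_add (dvd_sub hlx (Dvd.dvd.mul_left hPt s)) hdz
            rw [h1] at h
            rw [← dvd_neg]
            exact dvdc8 h (by ring)
          obtain ⟨c, hc⟩ := this
          rcases le_or_gt 0 c with hc0 | hc0
          · right
            obtain ⟨b, rfl⟩ := Int.eq_ofNat_of_zero_le hc0
            refine ⟨b, ?_, ?_⟩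
            · rw [le_div_iff₀ hlQ, mul_comm]
              have : (lam : ℤ) * b ≤ q - 3 := by linarith
              exact_mod_cast this
            · have : (i : ℤ) = A + B + b * q ^ t := by
                apply mul_left_cancel₀ hlz.ne'
                rw [hx, h1]
                linear_combination (q : ℤ) ^ t * hc - hA - hB
              exact_mod_cast this
          · left; left
            have hl2 : (2 : ℤ) ≤ lam := by exact_mod_cast hlam
            have h8 : (lam : ℤ) * c ≤ lam * (-1) := mul_le_mul_of_nonneg_left (by omega) hlz.le
            have hs : s = q := by linarith
            have hlc : (lam : ℤ) * c = -2 := by linarith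
            refine mT1 (-c) (by linarith) (by linarith) ?_
            rw [h1, hs]; linear_combination hlc
  · intro i h1 h2
    rw [div_le_iff₀ hlQ] at h1
    rw [le_div_iff₀ hlQ] at h2
    have h1' : 2 * (q : ℤ) ^ (t + 1) - 2 * q + 1 ≤ i * lam := by exact_mod_cast h1
    have h2' : (i : ℤ) * lam ≤ 2 * (q : ℤ) ^ (t + 1) + 2 * q - 1 := by exact_mod_cast h2
    rw [e1] at h1' h2'
    refine notlead8 q n lam (2 * t + 1) i t (by omega) (by omega) hN
      (((lam : ℤ) * i - 2 * (q * q ^ t)) * q ^ t - 2) ?_ ?_ ⟨2, by rw [e2]; ring⟩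
    · have : ((lam : ℤ) * i - 2 * (q * q ^ t)) * q ^ t ≤ (2 * q - 1) * q ^ t :=
        mul_le_mul_of_nonneg_right (by linarith) (by positivity)
      linarith
    · have : (-(2 * (q : ℤ) - 1)) * q ^ t ≤ ((lam : ℤ) * i - 2 * (q * q ^ t)) * q ^ t :=
        mul_le_mul_of_nonneg_right (by linarith) (by positivity)
      linarith
end
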